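/- arXiv:1108.4072 — 8 statements merged into one kernel-verified Lean document; each statement's English description precedes it below -/
import Mathlib

section
/- Let {g_α}_{α∈(0,α₀)} be an SRM with each g_α continuous, satisfying hypothesis H4: there exists k > 0 such that sup_{λ∈[0,‖T‖²]} |g_α(λ)| ≤ k/√α for all α ∈ (0,α₀). Let s ∈ 𝒮 and ρ ∈ 𝒪 with ρ continuous, and assume the uniform weak source-order bound: there exists c > 0 such that s(λ)·|r_α(λ)| ≤ c·ρ(α) for all α ∈ (0,α₀) and all λ ∈ (0,‖T‖²]. Let Θ(t) ≐ √t·ρ(t). Then for every ζ ∈ X with x ≐ s(T*T)ζ ≠ 0 and every p > max(1, ‖ζ‖), one has e(x,δ) ≤ p·(c + k‖T‖)·ρ(Θ⁻¹(δ)) for every δ ∈ (0, Θ(α₀⁻)). In particular ψ(x,δ) ≐ ρ(Θ⁻¹(δ)) is an upper bound of convergence for the total error of {R_α} on ran(s(T*T))∖{0}. -/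
open Filter Topology Set Asymptotics

noncomputable section

/-- `ρ ∈ 𝒪`: non-decreasing, positive on `(0,∞)`, with `ρ(α) → 0` as `α → 0⁺`. -/
def MemO (ρ : ℝ → ℝ) : Prop :=
  (∀ α > (0:ℝ), 0 < ρ α) ∧ (∀ a b : ℝ, 0 < a → a ≤ b → ρ a ≤ ρ b) ∧
    Tendsto ρ (𝓝[>] (0:ℝ)) (𝓝 0)

/-- `s ∈ 𝒮`: continuous on `[0,∞)`, `s 0 = 0`, nonnegative, positive on `(0,∞)`. -/
def MemS (s : ℝ → ℝ) : Prop :=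
  ContinuousOn s (Ici (0:ℝ)) ∧ s 0 = 0 ∧ (∀ t, 0 ≤ t → 0 ≤ s t) ∧ (∀ t, 0 < t → 0 < s t)

/-- Spectral regularization method on `[0,Λ]` (hypotheses H2, H3). -/
def IsSRM (α₀ Λ : ℝ) (g : ℝ → ℝ → ℝ) : Prop :=
  (∃ C > (0:ℝ), ∀ α ∈ Ioo (0:ℝ) α₀, ∀ lam ∈ Icc (0:ℝ) Λ, |lam * g α lam| ≤ C) ∧
  (∀ lam ∈ Ioc (0:ℝ) Λ, Tendsto (fun α => g α lam) (𝓝[>] (0:ℝ)) (𝓝 (1 / lam)))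

/-- `(s,ρ)` is a weak source-order pair: `limsup_{α→0⁺} s(λ)|r_α(λ)|/ρ(α) < ∞` for `λ ∈ (0,Λ]`. -/
def WeakSourceOrderPair (Λ : ℝ) (g : ℝ → ℝ → ℝ) (s ρ : ℝ → ℝ) : Prop :=
  ∀ lam ∈ Ioc (0:ℝ) Λ,
    Filter.limsup (fun α => ((s lam * |1 - lam * g α lam| / ρ α : ℝ) : EReal)) (𝓝[>] (0:ℝ)) < ⊤

/-- `(s,ρ)` is a strong source-order pair: weak, and the `limsup` is `> 0` for every `λ ∈ (0,Λ]`. -/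
def StrongSourceOrderPair (Λ : ℝ) (g : ℝ → ℝ → ℝ) (s ρ : ℝ → ℝ) : Prop :=
  WeakSourceOrderPair Λ g s ρ ∧
  ∀ lam ∈ Ioc (0:ℝ) Λ,
    0 < Filter.limsup (fun α => ((s lam * |1 - lam * g α lam| / ρ α : ℝ) : EReal)) (𝓝[>] (0:ℝ))

/-- `(ρ,s)` is an order-source pair: `∃ γ > 0` and `h → 0` with
`s(λ)|r_α(λ)| ≥ γ ρ(α)` for all `α ∈ (0,α₀)` and `λ ∈ [h(α),Λ]`. -/
def OrderSourcePair (α₀ Λ : ℝ) (g : ℝ → ℝ → ℝ) (ρ s : ℝ → ℝ) : Prop :=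
  ∃ γ > (0:ℝ), ∃ h : ℝ → ℝ, (∀ α ∈ Ioo (0:ℝ) α₀, 0 < h α) ∧
    Tendsto h (𝓝[>] (0:ℝ)) (𝓝 0) ∧
    ∀ α ∈ Ioo (0:ℝ) α₀, ∀ lam ∈ Icc (h α) Λ, γ * ρ α ≤ s lam * |1 - lam * g α lam|

/-- `ρ` is an optimal qualification of `{g_α}`. -/
def OptimalQualification (α₀ Λ : ℝ) (g : ℝ → ℝ → ℝ) (ρ : ℝ → ℝ) : Prop :=
  ∃ s : ℝ → ℝ, MemS s ∧ StrongSourceOrderPair Λ g s ρ ∧ OrderSourcePair α₀ Λ g ρ s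

variable {X Y : Type*} [NormedAddCommGroup X] [InnerProductSpace ℂ X] [CompleteSpace X]
  [NormedAddCommGroup Y] [InnerProductSpace ℂ Y] [CompleteSpace Y]

/-- The spectral regularization operators `R_α = g_α(T*T) T*`. -/
noncomputable def Rop (g : ℝ → ℝ → ℝ) (T : X →L[ℂ] Y) (α : ℝ) : Y →L[ℂ] X :=
  (cfc (g α) ((ContinuousLinearMap.adjoint T).comp T)).comp (ContinuousLinearMap.adjoint T)

/-- The total error `e(x,δ) = inf_{α∈(0,α₀)} sup_{‖Tx-y‖≤δ} ‖R_α y - x‖`. -/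
noncomputable def totErr (α₀ : ℝ) (T : X →L[ℂ] Y) (R : ℝ → Y →L[ℂ] X) (x : X) (δ : ℝ) : ℝ :=
  ⨅ α : Ioo (0:ℝ) α₀, ⨆ y : {y : Y // ‖T x - y‖ ≤ δ}, ‖R α.1 y.1 - x‖

/-- `ψ ∈ ℱ_M`: for some `a > 0`, `ψ` is positive on `M × (0,a)`, `ψ(x,δ) → 0` as `δ → 0⁺`,
and `ψ(x,·)` is continuous and non-decreasing on `(0,a)`. -/
def MemF (M : Set X) (ψ : X → ℝ → ℝ) : Prop :=
  ∃ a > (0:ℝ), (∀ x ∈ M, ∀ δ ∈ Ioo (0:ℝ) a, 0 < ψ x δ) ∧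
    (∀ x ∈ M, Tendsto (ψ x) (𝓝[>] (0:ℝ)) (𝓝 0)) ∧
    (∀ x ∈ M, ContinuousOn (ψ x) (Ioo (0:ℝ) a)) ∧
    (∀ x ∈ M, ∀ δ₁ ∈ Ioo (0:ℝ) a, ∀ δ₂ ∈ Ioo (0:ℝ) a, δ₁ ≤ δ₂ → ψ x δ₁ ≤ ψ x δ₂)

/-- `ψ` is an upper bound of convergence for the total error of `{R_α}` on `M`. -/
def IsUpperBoundOfConv (α₀ : ℝ) (T : X →L[ℂ] Y) (R : ℝ → Y →L[ℂ] X)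
    (M : Set X) (ψ : X → ℝ → ℝ) : Prop :=
  MemF M ψ ∧ ∃ r > (0:ℝ), ∃ p : X → ℝ, (∀ x ∈ M, 0 < p x) ∧
    ∀ x ∈ M, ∀ δ ∈ Ioo (0:ℝ) r, totErr α₀ T R x δ ≤ p x * ψ x δ

/-- `ψ` on `M` precedes `ψ'` on `M'`. -/
def Precedes (M M' : Set X) (ψ ψ' : X → ℝ → ℝ) : Prop :=
  ∃ d > (0:ℝ), ∃ K : X → X → ℝ, (∀ x ∈ M, ∀ x' ∈ M', 0 < K x x') ∧
    ∀ x ∈ M, ∀ x' ∈ M', ∀ δ ∈ Ioo (0:ℝ) d, ψ x δ ≤ K x x' * ψ' x' δ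

/-- Condition S1: for every `x* ≠ 0` and every `x ∈ M`,
`limsup_{δ→0⁺} e(x*,δ)/ψ(x,δ) > 0`. -/
def SatS1 (α₀ : ℝ) (T : X →L[ℂ] Y) (R : ℝ → Y →L[ℂ] X) (M : Set X) (ψ : X → ℝ → ℝ) : Prop :=
  ∀ xs : X, xs ≠ 0 → ∀ x ∈ M,
    0 < Filter.limsup (fun δ => ((totErr α₀ T R xs δ / ψ x δ : ℝ) : EReal)) (𝓝[>] (0:ℝ))

/-- `ψ` is a global saturation function of `{R_α}` over `M` (conditions S1, S2, S3). -/
def IsGlobalSaturation (α₀ : ℝ) (T : X →L[ℂ] Y) (R : ℝ → Y →L[ℂ] X)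
    (M : Set X) (ψ : X → ℝ → ℝ) : Prop :=
  IsUpperBoundOfConv α₀ T R M ψ ∧ SatS1 α₀ T R M ψ ∧ Precedes M M ψ ψ ∧
  ¬ ∃ (M' : Set X) (ψ' : X → ℝ → ℝ), M ⊂ M' ∧ (0:X) ∉ M' ∧ (∀ x ∈ M, ψ' x = ψ x) ∧
      IsUpperBoundOfConv α₀ T R M' ψ' ∧ SatS1 α₀ T R M' ψ' ∧ Precedes M' M' ψ' ψ'

theorem spectrum_adjoint_comp_self_subset_Icc (T : X →L[ℂ] Y) :
    spectrum ℝ ((ContinuousLinearMap.adjoint T).comp T) ⊆ Icc (0 : ℝ) (‖T‖ ^ 2) := by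
  intro l hl
  refine ⟨spectrum_nonneg_of_nonneg ((ContinuousLinearMap.nonneg_iff_isPositive _).2
    (ContinuousLinearMap.isPositive_adjoint_comp_self T)) hl, ?_⟩
  have h1 : ‖(1 : X →L[ℂ] X)‖ ≤ 1 := ContinuousLinearMap.norm_id_le
  have h := spectrum.norm_le_norm_mul_of_mem hl
  rw [ContinuousLinearMap.norm_adjoint_comp_self] at h
  calc l ≤ ‖l‖ := Real.le_norm_self l
    _ ≤ ‖T‖ * ‖T‖ * ‖(1 : X →L[ℂ] X)‖ := h
    _ ≤ ‖T‖ * ‖T‖ * 1 := by gcongr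
    _ = ‖T‖ ^ 2 := by ring

theorem norm_Rop_le (g : ℝ → ℝ → ℝ) (T : X →L[ℂ] Y) {α K : ℝ} (hK : 0 ≤ K)
    (hg : ∀ l ∈ Icc (0 : ℝ) (‖T‖ ^ 2), |g α l| ≤ K) :
    ‖Rop g T α‖ ≤ K * ‖T‖ := by
  refine (ContinuousLinearMap.opNorm_comp_le _ _).trans ?_
  rw [LinearIsometryEquiv.norm_map]
  gcongr
  exact norm_cfc_le hK fun l hl => hg l (spectrum_adjoint_comp_self_subset_Icc T hl)

/-- The approximation error at a source element is governed by `s(λ) |r_α(λ)|`. -/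
theorem norm_Rop_apply_sub_cfc_apply_le (g : ℝ → ℝ → ℝ) (T : X →L[ℂ] Y) (s : ℝ → ℝ) {α K : ℝ}
    (hg : ContinuousOn (g α) (Icc (0 : ℝ) (‖T‖ ^ 2)))
    (hs : ContinuousOn s (Icc (0 : ℝ) (‖T‖ ^ 2))) (hK : 0 ≤ K)
    (h : ∀ l ∈ Icc (0 : ℝ) (‖T‖ ^ 2), |s l| * |1 - l * g α l| ≤ K) (ζ : X) :
    ‖Rop g T α (T (cfc s ((ContinuousLinearMap.adjoint T).comp T) ζ)) -
      cfc s ((ContinuousLinearMap.adjoint T).comp T) ζ‖ ≤ K * ‖ζ‖ := by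
  have hsp := spectrum_adjoint_comp_self_subset_Icc T
  have hA : IsSelfAdjoint ((ContinuousLinearMap.adjoint T).comp T) :=
    (ContinuousLinearMap.isPositive_adjoint_comp_self T).isSelfAdjoint
  have hRop (x : X) : Rop g T α (T x) =
      (cfc (g α) ((ContinuousLinearMap.adjoint T).comp T) *
        (ContinuousLinearMap.adjoint T).comp T) x := rfl
  rw [hRop]
  generalize (ContinuousLinearMap.adjoint T).comp T = A at hsp hA
  have hgA := hg.mono hsp
  have hsA := hs.mono hsp
  have hidA : ContinuousOn (fun l : ℝ => l) (spectrum ℝ A) := continuousOn_id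
  have key : cfc (fun l => g α l * l * s l - s l) A = cfc (g α) A * A * cfc s A - cfc s A := by
    rw [cfc_sub (fun l => g α l * l * s l) s A ((hgA.mul hidA).mul hsA) hsA,
      cfc_mul (fun l => g α l * l) s A (hgA.mul hidA) hsA, cfc_mul (g α) (fun l => l) A hgA hidA,
      cfc_id' ℝ A]
  have hnorm : ‖cfc (fun l => g α l * l * s l - s l) A‖ ≤ K := by
    refine norm_cfc_le hK fun l hl => ?_
    refine le_trans (le_of_eq ?_) (h l (hsp hl))
    rw [Real.norm_eq_abs, ← abs_mul, ← abs_neg]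
    congr 1
    ring
  have happ : (cfc (g α) A * A) (cfc s A ζ) - cfc s A ζ =
      cfc (fun l => g α l * l * s l - s l) A ζ := by
    rw [key]; rfl
  rw [happ]
  exact ContinuousLinearMap.le_of_opNorm_le _ hnorm ζ

theorem totErr_le {E F : Type*} [NormedAddCommGroup E] [InnerProductSpace ℂ E]
    [NormedAddCommGroup F] [InnerProductSpace ℂ F]
    (α₀ : ℝ) (T : E →L[ℂ] F) (R : ℝ → F →L[ℂ] E) (x : E) {δ B : ℝ}
    (hδ : 0 ≤ δ) {α : ℝ} (hα : α ∈ Ioo (0 : ℝ) α₀)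
    (h : ∀ y : F, ‖T x - y‖ ≤ δ → ‖R α y - x‖ ≤ B) :
    totErr α₀ T R x δ ≤ B := by
  have : Nonempty {y : F // ‖T x - y‖ ≤ δ} := ⟨⟨T x, by simpa using hδ⟩⟩
  refine (ciInf_le ⟨0, ?_⟩ (⟨α, hα⟩ : Ioo (0 : ℝ) α₀)).trans (ciSup_le fun y => h y.1 y.2)
  rintro _ ⟨β, rfl⟩
  exact Real.iSup_nonneg fun y => norm_nonneg _

theorem MemO.strictMonoOn_sqrt_mul {ρ : ℝ → ℝ} (hρ : MemO ρ) :
    StrictMonoOn (fun t => Real.sqrt t * ρ t) (Ioi (0 : ℝ)) := fun a ha b _ hab =>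
  mul_lt_mul (Real.sqrt_lt_sqrt (le_of_lt ha) hab) (hρ.2.1 a b ha hab.le) (hρ.1 a ha)
    (Real.sqrt_nonneg b)

theorem MemO.sqrt_mul_mem_Ioo {ρ : ℝ → ℝ} (hρ : MemO ρ) {α₀ t : ℝ} (ht : t ∈ Ioo (0 : ℝ) α₀) :
    Real.sqrt t * ρ t ∈ Ioo (0 : ℝ) (sSup ((fun t => Real.sqrt t * ρ t) '' Ioo (0 : ℝ) α₀)) := by
  refine ⟨mul_pos (Real.sqrt_pos.2 ht.1) (hρ.1 t ht.1), ?_⟩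
  obtain ⟨u, htu, hu⟩ := exists_between ht.2
  have hu0 : 0 < u := ht.1.trans htu
  refine (hρ.strictMonoOn_sqrt_mul ht.1 hu0 htu).trans_le (le_csSup ?_ ⟨u, ⟨hu0, hu⟩, rfl⟩)
  refine ⟨Real.sqrt α₀ * ρ α₀, ?_⟩
  rintro _ ⟨v, hv, rfl⟩
  exact (hρ.strictMonoOn_sqrt_mul hv.1 (hv.1.trans hv.2) hv.2).le

/-- Properties of a right inverse of `t ↦ √t ρ(t)`: it is strictly increasing, continuous and
tends to `0` at `0⁺`. -/
theorem MemO.rightInverse_sqrt_mul {ρ : ℝ → ℝ} (hρ : MemO ρ) {α₀ : ℝ} (hα₀ : 0 < α₀)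
    {Θinv : ℝ → ℝ}
    (hΘinv : ∀ δ ∈ Ioo (0:ℝ) (sSup ((fun t => Real.sqrt t * ρ t) '' Ioo (0:ℝ) α₀)),
      Θinv δ ∈ Ioo (0:ℝ) α₀ ∧ Real.sqrt (Θinv δ) * ρ (Θinv δ) = δ) :
    StrictMonoOn Θinv (Ioo (0:ℝ) (sSup ((fun t => Real.sqrt t * ρ t) '' Ioo (0:ℝ) α₀))) ∧
    ContinuousOn Θinv (Ioo (0:ℝ) (sSup ((fun t => Real.sqrt t * ρ t) '' Ioo (0:ℝ) α₀))) ∧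
    Tendsto Θinv (𝓝[>] (0 : ℝ)) (𝓝[>] (0 : ℝ)) := by
  have hΘ := hρ.strictMonoOn_sqrt_mul
  have hmem := fun t (ht : t ∈ Ioo (0 : ℝ) α₀) => hρ.sqrt_mul_mem_Ioo ht
  set a := sSup ((fun t => Real.sqrt t * ρ t) '' Ioo (0:ℝ) α₀)
  have hmono : StrictMonoOn Θinv (Ioo 0 a) := by
    intro δ₁ h₁ δ₂ h₂ h
    have e₁ := hΘinv δ₁ h₁
    have e₂ := hΘinv δ₂ h₂
    rw [← hΘ.lt_iff_lt e₁.1.1 e₂.1.1]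
    simpa only [e₁.2, e₂.2] using h
  have hleft : ∀ t ∈ Ioo (0 : ℝ) α₀, Θinv (Real.sqrt t * ρ t) = t := fun t ht =>
    hΘ.injOn (hΘinv _ (hmem t ht)).1.1 ht.1 (hΘinv _ (hmem t ht)).2
  refine ⟨hmono, fun δ hδ => ?_, tendsto_nhdsWithin_iff.2 ⟨?_, ?_⟩⟩
  · refine (hmono.continuousAt_of_image_mem_nhds (Ioo_mem_nhds hδ.1 hδ.2) ?_).continuousWithinAt
    refine mem_of_superset (Ioo_mem_nhds (hΘinv δ hδ).1.1 (hΘinv δ hδ).1.2) fun t ht => ?_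
    exact ⟨_, hmem t ht, hleft t ht⟩
  · refine tendsto_order.2 ⟨fun b hb => ?_, fun b hb => ?_⟩
    · obtain ⟨t, ht⟩ := nonempty_Ioo.2 hα₀
      filter_upwards [Ioo_mem_nhdsGT ((hmem t ht).1.trans (hmem t ht).2)] with δ hδ
      exact hb.trans (hΘinv δ hδ).1.1
    · obtain ⟨t, ht0, ht⟩ := exists_between (lt_min hb hα₀)
      have ht' : t ∈ Ioo (0 : ℝ) α₀ := ⟨ht0, ht.trans_le (min_le_right _ _)⟩
      filter_upwards [Ioo_mem_nhdsGT (hmem t ht').1] with δ hδ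
      have hδ' : δ ∈ Ioo 0 a := ⟨hδ.1, hδ.2.trans (hmem t ht').2⟩
      have := hmono hδ' (hmem t ht') hδ.2
      rw [hleft t ht'] at this
      exact this.trans (ht.trans_le (min_le_left _ _))
  · obtain ⟨t, ht⟩ := nonempty_Ioo.2 hα₀
    filter_upwards [Ioo_mem_nhdsGT ((hmem t ht).1.trans (hmem t ht).2)] with δ hδ
    exact (hΘinv δ hδ).1.1

/-- for an SRM satisfying H4 and a weak source-order pair `(s,ρ)` with a
uniform constant `c`, the function `ψ(x,δ) = ρ(Θ⁻¹(δ))`, `Θ(t) = √t·ρ(t)`, satisfies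
`e(x,δ) ≤ p(c + k‖T‖)ρ(Θ⁻¹(δ))` for `x = s(T*T)ζ ≠ 0` and `p > max(1,‖ζ‖)`; in particular
`ψ` is an upper bound of convergence for the total error on `ran(s(T*T)) \ {0}`. -/
theorem stmt3 (T : X →L[ℂ] Y) (hT : ¬ IsClosed (Set.range T))
    (α₀ : ℝ) (hα₀ : 0 < α₀) (g : ℝ → ℝ → ℝ) (hg : IsSRM α₀ (‖T‖^2) g)
    (hgc : ∀ α ∈ Ioo (0:ℝ) α₀, ContinuousOn (g α) (Icc (0:ℝ) (‖T‖^2)))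
    (k : ℝ) (hk : 0 < k)
    (hH4 : ∀ α ∈ Ioo (0:ℝ) α₀, ∀ lam ∈ Icc (0:ℝ) (‖T‖^2), |g α lam| ≤ k / Real.sqrt α)
    (s ρ : ℝ → ℝ) (hs : MemS s) (hρ : MemO ρ) (hρc : ContinuousOn ρ (Ioi (0:ℝ)))
    (c : ℝ) (hc : 0 < c)
    (hweak : ∀ α ∈ Ioo (0:ℝ) α₀, ∀ lam ∈ Ioc (0:ℝ) (‖T‖^2),
      s lam * |1 - lam * g α lam| ≤ c * ρ α)
    (Θinv : ℝ → ℝ)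
    (hΘinv : ∀ δ ∈ Ioo (0:ℝ) (sSup ((fun t => Real.sqrt t * ρ t) '' Ioo (0:ℝ) α₀)),
      Θinv δ ∈ Ioo (0:ℝ) α₀ ∧ Real.sqrt (Θinv δ) * ρ (Θinv δ) = δ) :
    (∀ ζ : X, cfc s ((ContinuousLinearMap.adjoint T).comp T) ζ ≠ 0 →
      ∀ p : ℝ, max 1 ‖ζ‖ < p →
      ∀ δ ∈ Ioo (0:ℝ) (sSup ((fun t => Real.sqrt t * ρ t) '' Ioo (0:ℝ) α₀)),
        totErr α₀ T (Rop g T) (cfc s ((ContinuousLinearMap.adjoint T).comp T) ζ) δ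
          ≤ p * (c + k * ‖T‖) * ρ (Θinv δ)) ∧
    IsUpperBoundOfConv α₀ T (Rop g T)
      (Set.range (fun z => cfc s ((ContinuousLinearMap.adjoint T).comp T) z) \ {0})
      (fun _ δ => ρ (Θinv δ)) := by
  have hbound : ∀ ζ : X, ∀ p : ℝ, max 1 ‖ζ‖ < p →
      ∀ δ ∈ Ioo (0:ℝ) (sSup ((fun t => Real.sqrt t * ρ t) '' Ioo (0:ℝ) α₀)),
        totErr α₀ T (Rop g T) (cfc s ((ContinuousLinearMap.adjoint T).comp T) ζ) δ
          ≤ p * (c + k * ‖T‖) * ρ (Θinv δ) := by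
    intro ζ p hp δ hδ
    obtain ⟨hα, hαδ⟩ := hΘinv δ hδ
    set α := Θinv δ
    have hρα : 0 < ρ α := hρ.1 α hα.1
    have hsq : 0 < Real.sqrt α := Real.sqrt_pos.2 hα.1
    set x := cfc s ((ContinuousLinearMap.adjoint T).comp T) ζ
    refine totErr_le α₀ T (Rop g T) x hδ.1.le hα fun y hy => ?_
    have h₁ : ‖Rop g T α (T x) - x‖ ≤ c * ρ α * ‖ζ‖ := by
      refine norm_Rop_apply_sub_cfc_apply_le g T s (hgc α hα) (hs.1.mono Icc_subset_Ici_self)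
        (by positivity) (fun l hl => ?_) ζ
      rw [abs_of_nonneg (hs.2.2.1 l hl.1)]
      rcases hl.1.eq_or_lt with rfl | hl0
      · rw [hs.2.1, zero_mul]
        positivity
      · exact hweak α hα l ⟨hl0, hl.2⟩
    have h₂ : ‖Rop g T α (y - T x)‖ ≤ k * ‖T‖ * ρ α := by
      calc ‖Rop g T α (y - T x)‖ ≤ k / Real.sqrt α * ‖T‖ * ‖y - T x‖ :=
            ContinuousLinearMap.le_of_opNorm_le _ (norm_Rop_le g T (by positivity) (hH4 α hα)) _
        _ ≤ k / Real.sqrt α * ‖T‖ * (Real.sqrt α * ρ α) := by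
            rw [hαδ, norm_sub_rev]
            gcongr
        _ = k * ‖T‖ * ρ α := by field_simp
    calc ‖Rop g T α y - x‖ = ‖(Rop g T α (T x) - x) + Rop g T α (y - T x)‖ := by
          rw [map_sub]
          congr 1
          abel
      _ ≤ c * ρ α * ‖ζ‖ + k * ‖T‖ * ρ α := (norm_add_le _ _).trans (add_le_add h₁ h₂)
      _ ≤ c * ρ α * p + k * ‖T‖ * ρ α * p := by
          refine add_le_add ?_ (le_mul_of_one_le_right (by positivity)
            ((le_max_left _ _).trans_lt hp).le)
          gcongr
          exact ((le_max_right _ _).trans_lt hp).le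
      _ = p * (c + k * ‖T‖) * ρ α := by ring
  have hpos : 0 < sSup ((fun t => Real.sqrt t * ρ t) '' Ioo (0:ℝ) α₀) := by
    obtain ⟨t, ht⟩ := nonempty_Ioo.2 hα₀
    exact (hρ.sqrt_mul_mem_Ioo ht).1.trans (hρ.sqrt_mul_mem_Ioo ht).2
  obtain ⟨hmono, hcont, hlim⟩ := hρ.rightInverse_sqrt_mul hα₀ hΘinv
  refine ⟨fun ζ _ => hbound ζ, ⟨_, hpos, ?_, ?_, ?_, ?_⟩, _, hpos, ?_⟩
  · exact fun _ _ δ hδ => hρ.1 _ (hΘinv δ hδ).1.1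
  · exact fun _ _ => hρ.2.2.comp hlim
  · exact fun _ _ => hρc.comp hcont fun δ hδ => (hΘinv δ hδ).1.1
  · exact fun _ _ δ₁ h₁ δ₂ h₂ h => hρ.2.1 _ _ (hΘinv δ₁ h₁).1.1 (hmono.monotoneOn h₁ h₂ h)
  · choose! z hz using fun (x : X) (hx : x ∈ Set.range
      (fun z => cfc s ((ContinuousLinearMap.adjoint T).comp T) z)) => hx
    refine ⟨fun x => (max 1 ‖z x‖ + 1) * (c + k * ‖T‖), fun x _ => by positivity,
      fun x hx δ hδ => ?_⟩
    have h := hbound (z x) _ (lt_add_one _) δ hδ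
    rwa [show cfc s ((ContinuousLinearMap.adjoint T).comp T) (z x) = x from hz x hx.1] at h
end
end

section
/- Let {g_α}_{α∈(0,α₀)} be an SRM with each g_α continuous on [0,‖T‖²], R_α = g_α(T*T)T*, and suppose (ρ,s) is an order-source pair for {g_α} with function h, where ρ ∈ 𝒪 and s ∈ 𝒮. Assume: (b.ii) there exists γ₁ > 0 with r_α(λ) ≥ γ₁ for all α ∈ (0,α₀) and 0 ≤ λ < h(α); and (b.iii) for each fixed λ ∈ (0,‖T‖²], α ↦ |r_α(λ)| is non-decreasing. Let φ : (0,∞) → (0,∞) be continuous, non-decreasing, with lim_{δ→0⁺} φ(δ) = 0, and let x* ∈ X, x* ≠ 0. If e(x*,δ) = o(φ(δ)) as δ → 0⁺, then there exists an a-priori parameter choice rule α̃ : (0,∞) → (0,α₀) with lim_{δ→0⁺} α̃(δ) = 0 such that sup{‖R_{α̃(δ)} y − x*‖ : ‖Tx* − y‖ ≤ δ} = o(φ(δ)) as δ → 0⁺. -/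
open Filter Topology Set Asymptotics

noncomputable section

variable {X Y : Type*} [NormedAddCommGroup X] [InnerProductSpace ℂ X] [CompleteSpace X]
  [NormedAddCommGroup Y] [InnerProductSpace ℂ Y] [CompleteSpace Y]

/-- The spectrum of `T*T` is contained in `[0, ‖T‖²]`. -/
lemma spectrum_adjoint_comp_self_subset (T : X →L[ℂ] Y) :
    spectrum ℝ ((ContinuousLinearMap.adjoint T).comp T) ⊆ Icc 0 (‖T‖ ^ 2) := by
  intro t ht
  have hpos : 0 ≤ (ContinuousLinearMap.adjoint T).comp T :=
    (ContinuousLinearMap.nonneg_iff_isPositive _).2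
      (ContinuousLinearMap.isPositive_adjoint_comp_self T)
  have : Nontrivial (X →L[ℂ] X) := by
    by_contra hn
    rw [not_nontrivial_iff_subsingleton] at hn
    simp [spectrum.of_subsingleton] at ht
  have : Nontrivial X := by
    by_contra hn
    rw [not_nontrivial_iff_subsingleton] at hn
    exact not_subsingleton (X →L[ℂ] X) inferInstance
  refine ⟨spectrum_nonneg_of_nonneg hpos ht, ?_⟩
  have h1 := spectrum.norm_le_norm_of_mem ht
  rw [ContinuousLinearMap.norm_adjoint_comp_self] at h1
  nlinarith [le_abs_self t, Real.norm_eq_abs t]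

/-- The residual of a spectral method is `r(T*T) x` with `r(λ) = 1 - λ g(λ)`, so a lower bound on
`|r|` bounds `‖x‖` by the norm of the residual. -/
lemma norm_le_inv_mul_norm_Rop_sub (T : X →L[ℂ] Y) (g : ℝ → ℝ → ℝ) (α : ℝ)
    (hgc : ContinuousOn (g α) (Icc (0:ℝ) (‖T‖ ^ 2))) {c : ℝ} (hc : 0 < c)
    (hr : ∀ t ∈ Icc (0:ℝ) (‖T‖ ^ 2), c ≤ |1 - t * g α t|) (x : X) :
    ‖x‖ ≤ c⁻¹ * ‖Rop g T α (T x) - x‖ := by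
  set A : X →L[ℂ] X := (ContinuousLinearMap.adjoint T).comp T with hA
  have hspec : spectrum ℝ A ⊆ Icc 0 (‖T‖ ^ 2) := spectrum_adjoint_comp_self_subset T
  have hsa : IsSelfAdjoint A := (ContinuousLinearMap.isPositive_adjoint_comp_self T).isSelfAdjoint
  have hg : ContinuousOn (g α) (spectrum ℝ A) := hgc.mono hspec
  have hrc : ContinuousOn (fun t => 1 - t * g α t) (spectrum ℝ A) := by fun_prop
  have hr0 : ∀ t ∈ spectrum ℝ A, 1 - t * g α t ≠ 0 := fun t ht h0 => by
    have := hr t (hspec ht)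
    rw [h0, abs_zero] at this
    linarith
  have hric : ContinuousOn (fun t => (1 - t * g α t)⁻¹) (spectrum ℝ A) := hrc.inv₀ hr0
  have hres : cfc (fun t => 1 - t * g α t) A = 1 - cfc (g α) A * A := by
    rw [cfc_sub (fun _ => (1:ℝ)) (fun t => t * g α t) A, cfc_const_one ℝ A,
      cfc_mul (fun t => t) (g α) A, cfc_id' ℝ A,
      ((Commute.refl A).cfc_real (g α)).eq]
  have hinv : cfc (fun t => (1 - t * g α t)⁻¹) A * cfc (fun t => 1 - t * g α t) A = 1 := by
    rw [← cfc_mul _ _ A hric hrc, ← cfc_const_one ℝ A]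
    exact cfc_congr fun t ht => inv_mul_cancel₀ (hr0 t ht)
  have hnorm : ‖cfc (fun t => (1 - t * g α t)⁻¹) A‖ ≤ c⁻¹ := by
    refine norm_cfc_le (inv_nonneg.2 hc.le) fun t ht => ?_
    rw [norm_inv, Real.norm_eq_abs]
    exact inv_anti₀ hc (hr t (hspec ht))
  have hx : cfc (fun t => (1 - t * g α t)⁻¹) A (x - Rop g T α (T x)) = x := by
    have h1 : x - Rop g T α (T x) = cfc (fun t => 1 - t * g α t) A x := by
      rw [hres]; rfl
    rw [h1, ← mul_apply_eq_comp, hinv, one_apply_eq_self]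
  calc ‖x‖ = ‖cfc (fun t => (1 - t * g α t)⁻¹) A (x - Rop g T α (T x))‖ := by rw [hx]
    _ ≤ ‖cfc (fun t => (1 - t * g α t)⁻¹) A‖ * ‖x - Rop g T α (T x)‖ :=
      ContinuousLinearMap.le_opNorm _ _
    _ ≤ c⁻¹ * ‖Rop g T α (T x) - x‖ := by
      rw [norm_sub_rev]
      gcongr

/-- The worst-case errors of a bounded operator over a noise ball are bounded. -/
lemma bddAbove_norm_apply_sub (T : X →L[ℂ] Y) (R : Y →L[ℂ] X) (x : X) (δ : ℝ) :
    BddAbove (range fun y : {y : Y // ‖T x - y‖ ≤ δ} => ‖R y.1 - x‖) := by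
  refine ⟨‖R‖ * δ + ‖R (T x) - x‖, ?_⟩
  rintro _ ⟨⟨y, hy⟩, rfl⟩
  calc ‖R y - x‖ = ‖-R (T x - y) + (R (T x) - x)‖ := by
        rw [map_sub]; congr 1; abel
    _ ≤ ‖-R (T x - y)‖ + ‖R (T x) - x‖ := norm_add_le _ _
    _ ≤ ‖R‖ * δ + ‖R (T x) - x‖ := by
      rw [norm_neg]
      gcongr
      exact R.le_opNorm_of_le hy

/-- under (b.ii), (b.iii) and an order-source pair `(ρ,s)`, if the total
error at `x* ≠ 0` is `o(φ(δ))` as `δ → 0⁺`, then there is an a-priori parameter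
choice rule `α̃(δ) ∈ (0,α₀)` with `α̃(δ) → 0` realizing the same `o(φ(δ))` bound for
the worst-case error. -/
theorem stmt5 (T : X →L[ℂ] Y) (hT : ¬ IsClosed (Set.range T))
    (α₀ : ℝ) (hα₀ : 0 < α₀) (g : ℝ → ℝ → ℝ) (hg : IsSRM α₀ (‖T‖^2) g)
    (hgc : ∀ α ∈ Ioo (0:ℝ) α₀, ContinuousOn (g α) (Icc (0:ℝ) (‖T‖^2)))
    (ρ s : ℝ → ℝ) (hρ : MemO ρ) (hs : MemS s)
    (γ : ℝ) (hγ : 0 < γ) (h : ℝ → ℝ) (hhpos : ∀ α ∈ Ioo (0:ℝ) α₀, 0 < h α)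
    (hh0 : Tendsto h (𝓝[>] (0:ℝ)) (𝓝 0))
    (hos : ∀ α ∈ Ioo (0:ℝ) α₀, ∀ lam ∈ Icc (h α) (‖T‖^2),
      γ * ρ α ≤ s lam * |1 - lam * g α lam|)
    (γ₁ : ℝ) (hγ₁ : 0 < γ₁)
    (hbii : ∀ α ∈ Ioo (0:ℝ) α₀, ∀ lam : ℝ, 0 ≤ lam → lam < h α → γ₁ ≤ 1 - lam * g α lam)
    (hbiii : ∀ lam ∈ Ioc (0:ℝ) (‖T‖^2), ∀ a b : ℝ, a ∈ Ioo (0:ℝ) α₀ → b ∈ Ioo (0:ℝ) α₀ →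
      a ≤ b → |1 - lam * g a lam| ≤ |1 - lam * g b lam|)
    (φ : ℝ → ℝ) (hφc : ContinuousOn φ (Ioi (0:ℝ))) (hφpos : ∀ δ > (0:ℝ), 0 < φ δ)
    (hφmono : ∀ a b : ℝ, 0 < a → a ≤ b → φ a ≤ φ b)
    (hφ0 : Tendsto φ (𝓝[>] (0:ℝ)) (𝓝 0))
    (x : X) (hx : x ≠ 0)
    (he : (fun δ => totErr α₀ T (Rop g T) x δ) =o[𝓝[>] (0:ℝ)] φ) :
    ∃ αp : ℝ → ℝ, (∀ δ > (0:ℝ), αp δ ∈ Ioo (0:ℝ) α₀) ∧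
      Tendsto αp (𝓝[>] (0:ℝ)) (𝓝 0) ∧
      (fun δ => ⨆ y : {y : Y // ‖T x - y‖ ≤ δ}, ‖Rop g T (αp δ) y.1 - x‖)
        =o[𝓝[>] (0:ℝ)] φ := by
  set F : ℝ → ℝ → ℝ := fun α δ => ⨆ y : {y : Y // ‖T x - y‖ ≤ δ}, ‖Rop g T α y.1 - x‖ with hF
  have hF0 : ∀ α δ, 0 ≤ F α δ := fun α δ => Real.iSup_nonneg fun _ => norm_nonneg _
  have hchoice : ∀ δ : ℝ, ∃ α ∈ Ioo (0:ℝ) α₀,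
      0 < δ → F α δ ≤ totErr α₀ T (Rop g T) x δ + δ * φ δ := by
    intro δ
    by_cases hδ : 0 < δ
    · have : Nonempty (Ioo (0:ℝ) α₀) := ⟨⟨α₀ / 2, by constructor <;> linarith⟩⟩
      obtain ⟨α, hα⟩ := exists_lt_of_ciInf_lt
        (lt_add_of_pos_right (totErr α₀ T (Rop g T) x δ) (mul_pos hδ (hφpos δ hδ)))
      exact ⟨α.1, α.2, fun _ => hα.le⟩
    · exact ⟨α₀ / 2, by constructor <;> linarith, fun h => absurd h hδ⟩
  choose αp hαp hle using hchoice
  have hlittle : (fun δ => F (αp δ) δ) =o[𝓝[>] (0:ℝ)] φ := by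
    have hid : (fun δ : ℝ => δ) =o[𝓝[>] (0:ℝ)] (fun _ => (1:ℝ)) :=
      (isLittleO_one_iff ℝ).2 (tendsto_id.mono_left nhdsWithin_le_nhds)
    have hmul : (fun δ => δ * φ δ) =o[𝓝[>] (0:ℝ)] φ := by
      simpa using hid.mul_isBigO (isBigO_refl φ (𝓝[>] (0:ℝ)))
    refine IsBigO.trans_isLittleO (IsBigO.of_bound 1 ?_) (he.add hmul)
    filter_upwards [self_mem_nhdsWithin] with δ hδ
    rw [one_mul, Real.norm_of_nonneg (hF0 _ _)]
    exact (hle δ hδ).trans (le_abs_self _)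
  have hFlim : Tendsto (fun δ => F (αp δ) δ) (𝓝[>] (0:ℝ)) (𝓝 0) := hlittle.trans_tendsto hφ0
  refine ⟨αp, fun δ _ => hαp δ, ?_, hlittle⟩
  rw [Metric.tendsto_nhds]
  intro ε₀ hε₀
  obtain ⟨ε, hε, hεε₀⟩ : ∃ ε ∈ Ioo (0:ℝ) α₀, ε ≤ ε₀ :=
    ⟨min ε₀ (α₀ / 2), ⟨by positivity, (min_le_right _ _).trans_lt (by linarith)⟩, min_le_left _ _⟩
  obtain ⟨c, hc, hcr⟩ : ∃ c > (0:ℝ), ∀ t ∈ Icc (0:ℝ) (‖T‖ ^ 2), c ≤ |1 - t * g ε t| := by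
    have hcont : ContinuousOn (fun t => |1 - t * g ε t|) (Icc (0:ℝ) (‖T‖ ^ 2)) := by
      have := hgc ε hε
      fun_prop
    obtain ⟨t₀, ht₀, hmin⟩ :=
      isCompact_Icc.exists_isMinOn (nonempty_Icc.2 (sq_nonneg ‖T‖)) hcont
    refine ⟨_, ?_, fun t ht => hmin ht⟩
    rcases lt_or_ge t₀ (h ε) with hlt | hge
    · exact (hγ₁.trans_le (hbii ε hε t₀ ht₀.1 hlt)).trans_le (le_abs_self _)
    · refine pos_of_mul_pos_right ?_ (hs.2.2.1 t₀ ht₀.1)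
      exact (mul_pos hγ (hρ.1 ε hε.1)).trans_le (hos ε hε t₀ ⟨hge, ht₀.2⟩)
  have hsmall : ∀ᶠ δ in 𝓝[>] (0:ℝ), F (αp δ) δ < c * ‖x‖ :=
    hFlim.eventually_lt_const (mul_pos hc (norm_pos_iff.2 hx))
  filter_upwards [hsmall, self_mem_nhdsWithin] with δ hδ hδ0
  have hδ0' : 0 < δ := hδ0
  rw [Real.dist_eq, sub_zero, abs_of_pos (hαp δ).1]
  by_contra! hcon
  have hr : ∀ t ∈ Icc (0:ℝ) (‖T‖ ^ 2), c ≤ |1 - t * g (αp δ) t| := by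
    intro t ht
    rcases ht.1.eq_or_lt with rfl | ht0
    · simpa using hcr 0 ht
    · exact (hcr t ht).trans (hbiii t ⟨ht0, ht.2⟩ ε (αp δ) hε (hαp δ) (hεε₀.trans hcon))
  have hxle := norm_le_inv_mul_norm_Rop_sub T g (αp δ) (hgc _ (hαp δ)) hc hr x
  have hFle : ‖Rop g T (αp δ) (T x) - x‖ ≤ F (αp δ) δ :=
    le_ciSup (bddAbove_norm_apply_sub T (Rop g T (αp δ)) x δ) ⟨T x, by simpa using hδ0'.le⟩
  rw [inv_mul_eq_div, le_div_iff₀ hc] at hxle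
  linarith
end
end

section
/- Let T be injective, {g_α}_{α∈(0,α₀)} an SRM with each g_α continuous on [0,‖T‖²], R_α = g_α(T*T)T*, and (ρ,s) an order-source pair for {g_α} with function h, ρ ∈ 𝒪 continuous, s ∈ 𝒮, Θ(t) ≐ √t·ρ(t). Assume: (a) ρ is of local upper type β for some β ≥ 0; (b) there exist constants γ₁, γ₂ > 0, λ* ∈ (0,‖T‖²] and c₁ > 1 such that (b.i) 0 ≤ r_α(λ) ≤ 1 for all α > 0 and λ ∈ [0,λ*]; (b.ii) r_α(λ) ≥ γ₁ for all α ∈ (0,α₀) and 0 ≤ λ < h(α) ≤ λ*; (b.iii) for each fixed λ ∈ (0,‖T‖²], α ↦ |r_α(λ)| is non-decreasing; (b.iv) g_α(c₁α) ≥ γ₂/α whenever 0 < c₁α ≤ λ*; (b.v) g_α(λ) ≥ g_α(λ̃) whenever 0 < α ≤ λ ≤ λ̃ ≤ λ*; and (c) there exist a sequence {λ_n} contained in the spectrum of TT* and a constant c ≥ 1 such that λ_n decreases strictly to 0 and λ_n/λ_{n+1} ≤ c for every n. If x ∈ X satisfies sup_{y: ‖Tx−y‖≤δ} inf_{α∈(0,α₀)}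 ‖R_α y − x‖ = O(ρ(Θ⁻¹(δ))) as δ → 0⁺, then x ∈ ran(s(T*T)). -/
open Filter Topology Set Asymptotics

noncomputable section

variable {X Y : Type*} [NormedAddCommGroup X] [InnerProductSpace ℂ X] [CompleteSpace X]
  [NormedAddCommGroup Y] [InnerProductSpace ℂ Y] [CompleteSpace Y]

theorem re_inner_cfc_mono {A : X →L[ℂ] X} {f k : ℝ → ℝ}
    (hf : ContinuousOn f (spectrum ℝ A)) (hk : ContinuousOn k (spectrum ℝ A))
    (hfk : ∀ t ∈ spectrum ℝ A, f t ≤ k t) (x : X) :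
    (inner ℂ (cfc f A x) x).re ≤ (inner ℂ (cfc k A x) x).re := by
  have := (ContinuousLinearMap.le_def _ _).1 (cfc_mono (a := A) hfk hf hk)
  have := this.re_inner_nonneg_left x
  simpa [inner_sub_left] using this

theorem re_inner_cfc_cfc {A : X →L[ℂ] X} {f k : ℝ → ℝ}
    (hf : ContinuousOn f (spectrum ℝ A)) (hk : ContinuousOn k (spectrum ℝ A)) (x y: X) :
    inner ℂ (cfc f A x) (cfc k A y) = inner ℂ (cfc (fun t => k t * f t) A x) y := by
  rw [cfc_mul k f A hk hf]
  change _ = inner ℂ (cfc k A (cfc f A x)) y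
  have hs : IsSelfAdjoint (cfc k A) := IsSelfAdjoint.cfc
  rw [← hs.adjoint_eq, ContinuousLinearMap.adjoint_inner_left, hs.adjoint_eq]

theorem norm_sq_cfc_apply {A : X →L[ℂ] X} {f : ℝ → ℝ}
    (hf : ContinuousOn f (spectrum ℝ A)) (x : X) :
    ‖cfc f A x‖ ^ 2 = (inner ℂ (cfc (fun t => f t * f t) A x) x).re := by
  rw [← re_inner_cfc_cfc hf hf, ← inner_self_eq_norm_sq (𝕜 := ℂ)]; rfl

theorem norm_cfc_apply_le {A : X →L[ℂ] X} {f k : ℝ → ℝ}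
    (hf : ContinuousOn f (spectrum ℝ A)) (hk : ContinuousOn k (spectrum ℝ A))
    (hfk : ∀ t ∈ spectrum ℝ A, |f t| ≤ |k t|) (x : X) :
    ‖cfc f A x‖ ≤ ‖cfc k A x‖ := by
  refine le_of_sq_le_sq ?_ (norm_nonneg _)
  rw [norm_sq_cfc_apply hf, norm_sq_cfc_apply hk]
  refine re_inner_cfc_mono (hf.mul hf) (hk.mul hk) (fun t ht => ?_) x
  rw [← sq, ← sq]
  exact sq_le_sq.2 (hfk t ht)


theorem mul_cfc_apply {A : X →L[ℂ] X} (hA : IsSelfAdjoint A) {f : ℝ → ℝ}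
    (hf : ContinuousOn f (spectrum ℝ A)) (x : X) :
    A (cfc f A x) = cfc (fun t => t * f t) A x := by
  rw [cfc_mul (fun t => t) f A continuousOn_id hf, cfc_id' ℝ A]; rfl

theorem cauchySeq_of_norm_sub_sq_le {E : Type*} [SeminormedAddCommGroup E] {z : ℕ → E} {M : ℝ}
    (hM : ∀ n, ‖z n‖ ≤ M) (hz : ∀ n m, n ≤ m → ‖z m - z n‖ ^ 2 ≤ ‖z m‖ ^ 2 - ‖z n‖ ^ 2) :
    CauchySeq z := by
  have hmono : Monotone fun n => ‖z n‖ ^ 2 := fun n m hnm => by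
    have := hz n m hnm
    have := sq_nonneg ‖z m - z n‖
    simp only
    linarith
  have hbdd : BddAbove (range fun n => ‖z n‖ ^ 2) := by
    refine ⟨M ^ 2, ?_⟩
    rintro _ ⟨n, rfl⟩
    exact pow_le_pow_left₀ (norm_nonneg _) (hM n) 2
  refine Metric.cauchySeq_iff'.2 fun ε hε => ?_
  obtain ⟨_, ⟨N, rfl⟩, hN⟩ := exists_lt_of_lt_csSup (range_nonempty fun n => ‖z n‖ ^ 2)
    (sub_lt_self (sSup (range fun n => ‖z n‖ ^ 2)) (pow_pos hε 2))
  refine ⟨N, fun n hn => ?_⟩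
  have h1 := hz N n hn
  have h2 := le_csSup hbdd ⟨n, rfl⟩
  simp only at h2 hN
  rw [dist_eq_norm]
  exact lt_of_pow_lt_pow_left₀ 2 hε.le (by linarith)

/-- A Picard-type criterion for membership in the range of `cfc s A`. -/
theorem mem_range_cfc_of_norm_cfc_le {A : X →L[ℂ] X} (hA : IsSelfAdjoint A)
    (hA0 : ∀ t ∈ spectrum ℝ A, 0 ≤ t) (hinj : Function.Injective A)
    {s : ℝ → ℝ} (hs : ContinuousOn s (Ici 0)) (hs0 : ∀ t, 0 < t → 0 < s t) {x : X} {M : ℝ}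
    (H : ∀ ε > (0:ℝ), ∃ r : ℝ → ℝ, ContinuousOn r (spectrum ℝ A) ∧
      (∀ t ∈ spectrum ℝ A, ε ≤ t → 1 ≤ s t * |r t|) ∧ ‖cfc r A x‖ ≤ M) :
    x ∈ range fun z => cfc s A z := by
  have hsA : ContinuousOn s (spectrum ℝ A) := hs.mono hA0
  let χ : ℕ → ℝ → ℝ := fun n t => max 0 (min 1 ((n + 1) * t - 1))
  have hε : ∀ n : ℕ, (0:ℝ) < 1 / (n + 1) := fun n => by positivity
  have hχc : ∀ n, Continuous (χ n) := fun n => by fun_prop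
  have hχ0 : ∀ n t, 0 ≤ χ n t := fun n t => le_max_left _ _
  have hχ1 : ∀ n t, χ n t ≤ 1 := fun n t => max_le zero_le_one (min_le_left _ _)
  have hχz : ∀ (n : ℕ) t, t ≤ 1 / ((n:ℝ) + 1) → χ n t = 0 := fun n t ht => by
    have : ((n:ℝ) + 1) * t ≤ 1 := by
      rw [le_div_iff₀ (by positivity)] at ht; linarith
    exact max_eq_left ((min_le_right _ _).trans (by linarith))
  have hχu : ∀ (n : ℕ) t, 2 / ((n:ℝ) + 1) ≤ t → χ n t = 1 := fun n t ht => by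
    have : 2 ≤ ((n:ℝ) + 1) * t := by
      rw [div_le_iff₀ (by positivity)] at ht; linarith
    simp only [χ]
    rw [min_eq_left (by linarith), max_eq_right zero_le_one]
  have hχm : ∀ n m : ℕ, n ≤ m → ∀ t, 0 ≤ t → χ n t ≤ χ m t := fun n m hnm t ht => by
    have : (n:ℝ) ≤ m := by exact_mod_cast hnm
    have := mul_le_mul_of_nonneg_right this ht
    exact max_le_max le_rfl (min_le_min le_rfl (by linarith))
  let φ : ℕ → ℝ → ℝ := fun n t => χ n t / s (max t (1 / ((n:ℝ) + 1)))
  have hmp : ∀ (n : ℕ) t, 0 < max t (1 / ((n:ℝ) + 1)) := fun n t => lt_max_of_lt_right (hε n)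
  have hφc : ∀ n, Continuous (φ n) := fun n => by
    refine (hχc n).div ?_ fun t => (hs0 _ (hmp n t)).ne'
    exact hs.comp_continuous (by fun_prop) fun t => (hmp n t).le
  have hφ : ∀ n t, 0 ≤ t → φ n t = χ n t / s t := fun n t ht => by
    rcases le_total t (1 / ((n:ℝ) + 1)) with h | h
    · simp [φ, hχz n t h]
    · simp only [φ, max_eq_left h]
  have hsφ : ∀ n, ∀ t, 0 ≤ t → s t * φ n t = χ n t := fun n t ht => by
    rcases ht.eq_or_lt with rfl | h
    · simp [hφ n 0 le_rfl, hχz n 0 (hε n).le]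
    · rw [hφ n t ht, mul_div_cancel₀ _ (hs0 t h).ne']
  have hφnn : ∀ n t, 0 ≤ φ n t := fun n t => div_nonneg (hχ0 n t) (hs0 _ (hmp n t)).le
  have hφm : ∀ n m : ℕ, n ≤ m → ∀ t, 0 ≤ t → φ n t ≤ φ m t := fun n m hnm t ht => by
    rw [hφ n t ht, hφ m t ht]
    rcases ht.eq_or_lt with rfl | h
    · simp [hχz _ 0 (hε _).le]
    · exact div_le_div_of_nonneg_right (hχm n m hnm t ht) (hs0 t h).le
  have hcau : CauchySeq fun n => cfc (φ n) A x := by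
    refine cauchySeq_of_norm_sub_sq_le (M := M) (fun n => ?_) fun n m hnm => ?_
    · obtain ⟨r, hrc, hr, hrM⟩ := H _ (hε n)
      refine le_trans (norm_cfc_apply_le (hφc n).continuousOn hrc (fun t ht => ?_) x) hrM
      rw [abs_of_nonneg (hφnn n t)]
      rcases le_total t (1 / ((n:ℝ) + 1)) with h | h
      · rw [hφ n t (hA0 t ht), hχz n t h, zero_div]; exact abs_nonneg _
      · have hst := hs0 t ((hε n).trans_le h)
        rw [hφ n t (hA0 t ht), div_le_iff₀ hst, mul_comm]
        exact (hχ1 n t).trans (hr t ht h)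
    · have e : cfc (φ m) A x - cfc (φ n) A x = cfc (fun t => φ m t - φ n t) A x := by
        rw [cfc_sub (φ m) (φ n) A (hφc m).continuousOn (hφc n).continuousOn]; rfl
      have hcm : ContinuousOn (fun t => φ m t * φ m t) (spectrum ℝ A) :=
        ((hφc m).mul (hφc m)).continuousOn
      have hcn : ContinuousOn (fun t => φ n t * φ n t) (spectrum ℝ A) :=
        ((hφc n).mul (hφc n)).continuousOn
      have hcs : ContinuousOn (fun t => φ m t - φ n t) (spectrum ℝ A) :=
        ((hφc m).sub (hφc n)).continuousOn
      have e2 : (inner ℂ (cfc (fun t => φ m t * φ m t - φ n t * φ n t) A x) x).re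
          = ‖cfc (φ m) A x‖ ^ 2 - ‖cfc (φ n) A x‖ ^ 2 := by
        rw [norm_sq_cfc_apply (hφc m).continuousOn, norm_sq_cfc_apply (hφc n).continuousOn,
          cfc_sub _ _ A hcm hcn, sub_apply, inner_sub_left, Complex.sub_re]
      rw [e, norm_sq_cfc_apply hcs, ← e2]
      refine re_inner_cfc_mono (hcs.mul hcs) (hcm.sub hcn) (fun t ht => ?_) x
      have h1 := hφm n m hnm t (hA0 t ht)
      have h2 := hφnn n t
      change (φ m t - φ n t) * (φ m t - φ n t) ≤ φ m t * φ m t - φ n t * φ n t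
      nlinarith
  obtain ⟨z, hz⟩ := cauchySeq_tendsto_of_complete hcau
  refine ⟨z, (sub_eq_zero.1 (hinj ?_)).symm⟩
  rw [map_zero]
  have hlim : Tendsto (fun n => A (x - cfc s A (cfc (φ n) A x))) atTop
      (𝓝 (A (x - cfc s A z))) :=
    (A.continuous.tendsto _).comp
      (tendsto_const_nhds.sub (((cfc s A).continuous.tendsto _).comp hz))
  refine tendsto_nhds_unique hlim (squeeze_zero_norm (a := fun n : ℕ => 2 / ((n:ℝ) + 1) * ‖x‖)
    (fun n => ?_) ?_)
  · have e : x - cfc s A (cfc (φ n) A x) = cfc (fun t => 1 - χ n t) A x := by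
      rw [cfc_sub _ _ A continuousOn_const (hχc n).continuousOn, cfc_const_one ℝ A,
        ← cfc_congr fun t ht => hsφ n t (hA0 t ht), cfc_mul s (φ n) A hsA (hφc n).continuousOn]
      rfl
    have hc1 : ContinuousOn (fun t => 1 - χ n t) (spectrum ℝ A) :=
      (continuous_const.sub (hχc n)).continuousOn
    rw [e, mul_cfc_apply hA hc1]
    refine (ContinuousLinearMap.le_opNorm _ _).trans
      (mul_le_mul_of_nonneg_right (norm_cfc_le (by positivity) fun t ht => ?_) (norm_nonneg _))
    have h0 := hA0 t ht
    rw [Real.norm_eq_abs, abs_of_nonneg (mul_nonneg h0 (sub_nonneg.2 (hχ1 n t)))]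
    rcases le_total t (2 / ((n:ℝ) + 1)) with h | h
    · have := hχ0 n t
      nlinarith
    · rw [hχu n t h, sub_self, mul_zero]; positivity
  · have h1 := (tendsto_const_div_atTop_nhds_zero_nat (2:ℝ)).comp (tendsto_add_atTop_nat 1)
    have h2 := h1.mul_const ‖x‖
    rw [zero_mul] at h2
    refine h2.congr fun n => ?_
    simp

open ContinuousLinearMap in
theorem mem_spectrum_adjoint_comp_self (T : X →L[ℂ] Y) {μ : ℝ} (hμ : μ ≠ 0)
    (h : (μ : ℂ) ∈ spectrum ℂ (T.comp (adjoint T))) :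
    μ ∈ spectrum ℝ ((adjoint T).comp T) := by
  rw [← spectrum.algebraMap_mem_iff ℂ]
  change (μ : ℂ) ∈ _
  contrapose! h
  rw [spectrum.notMem_iff] at h ⊢
  obtain ⟨u, hu⟩ := h
  have hμ' : (μ : ℂ) ≠ 0 := by exact_mod_cast hμ
  set S := adjoint T
  let V : X →L[ℂ] X := ↑u⁻¹
  have h1 : ∀ x, (μ : ℂ) • V x - S (T (V x)) = x := fun x => by
    have := congrArg (fun L : X →L[ℂ] X => L x) u.mul_inv
    rw [hu] at this
    simpa [Algebra.algebraMap_eq_smul_one] using this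
  have h2 : ∀ x, V ((μ : ℂ) • x - S (T x)) = x := fun x => by
    have := congrArg (fun L : X →L[ℂ] X => L x) u.inv_mul
    rw [hu] at this
    simpa [Algebra.algebraMap_eq_smul_one] using this
  let W : Y →L[ℂ] Y := (μ : ℂ)⁻¹ • (1 + T.comp (V.comp S))
  refine ⟨⟨_, W, ?_, ?_⟩, rfl⟩
  · ext y
    have h3 := congrArg T (h1 (S y))
    rw [map_sub, map_smul, sub_eq_iff_eq_add] at h3
    change (μ : ℂ) • ((μ : ℂ)⁻¹ • (y + T (V (S y)))) - T (S ((μ : ℂ)⁻¹ • (y + T (V (S y))))) = y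
    rw [smul_inv_smul₀ hμ', map_smul, map_smul, map_add, map_add, ← h3, inv_smul_smul₀ hμ',
      add_sub_cancel_right]
  · ext y
    have h3 := h2 (S y)
    change (μ : ℂ)⁻¹ • (((μ : ℂ) • y - T (S y)) + T (V (S ((μ : ℂ) • y - T (S y))))) = y
    rw [map_sub S, map_smul S, h3, sub_add_cancel, inv_smul_smul₀ hμ']

theorem exists_cfc_apply_ne_zero {A : X →L[ℂ] X} (hA : IsSelfAdjoint A) {f : ℝ → ℝ}
    (hf : ContinuousOn f (spectrum ℝ A)) {μ : ℝ} (hμ : μ ∈ spectrum ℝ A) (hfμ : f μ ≠ 0) :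
    ∃ v, cfc f A v ≠ 0 := by
  by_contra! h
  have h0 : cfc f A = 0 := ContinuousLinearMap.ext h
  have : f μ ∈ spectrum ℝ (cfc f A) := by
    rw [cfc_map_spectrum f A hA hf]; exact ⟨μ, hμ, rfl⟩
  have : Nontrivial (X →L[ℂ] X) := by
    by_contra hn
    rw [not_nontrivial_iff_subsingleton] at hn
    simp [spectrum.of_subsingleton] at this
  rw [h0, spectrum.zero_eq] at *
  simp_all

open ContinuousLinearMap in
/-- Perturbing exact data `T x` in the spectral directions near `μ` gives noisy data on which every
reconstruction with filter `k` is at least as bad as both its bias and its noise amplification. -/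
theorem exists_perturbation (T : X →L[ℂ] Y) (hinj : Function.Injective T) (x : X)
    {a b μ δ : ℝ} (ha : 0 < a) (haμ : a < μ) (hμb : μ < b)
    (hμ : μ ∈ spectrum ℝ ((adjoint T).comp T)) (hδ : 0 < δ) :
    ∃ p : Y, ‖p‖ = δ ∧ ∀ (k : ℝ → ℝ) (q : ℝ),
      ContinuousOn k (spectrum ℝ ((adjoint T).comp T)) → 0 ≤ q →
      (∀ t ∈ Icc a b, 0 ≤ k t ∧ 0 ≤ 1 - t * k t ∧ q ^ 2 ≤ t * k t ^ 2) →
      ‖cfc (fun t => 1 - t * k t) ((adjoint T).comp T) x‖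
          ≤ ‖cfc k ((adjoint T).comp T) (adjoint T (T x + p)) - x‖ ∧
        q * δ ≤ ‖cfc k ((adjoint T).comp T) (adjoint T (T x + p)) - x‖ := by
  set A := (adjoint T).comp T with hAdef
  have hA : IsSelfAdjoint A := (isPositive_adjoint_comp_self T).isSelfAdjoint
  let f : ℝ → ℝ := fun t => max 0 (min (t - a) (b - t))
  have hfc : ContinuousOn f (spectrum ℝ A) := by
    have : Continuous f := by fun_prop
    exact this.continuousOn
  have hf0 : ∀ t, 0 ≤ f t := fun t => le_max_left _ _
  have hfz : ∀ t, t ∉ Icc a b → f t = 0 := fun t ht => by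
    refine max_eq_left ?_
    by_contra! hc
    rw [lt_min_iff] at hc
    exact ht ⟨by linarith, by linarith⟩
  have hfμ : f μ ≠ 0 :=
    (lt_max_of_lt_right (lt_min (sub_pos.2 haμ) (sub_pos.2 hμb))).ne'
  obtain ⟨v, hv, hvx⟩ : ∃ v, cfc f A v ≠ 0 ∧ (v = x ∨ cfc f A x = 0) := by
    by_cases hx : cfc f A x = 0
    · obtain ⟨v, hv⟩ := exists_cfc_apply_ne_zero hA hfc hμ hfμ
      exact ⟨v, hv, Or.inr hx⟩
    · exact ⟨x, hx, Or.inl rfl⟩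
  have hN : 0 < ‖T (cfc f A v)‖ := by
    rw [norm_pos_iff, Ne, map_eq_zero_iff T hinj]
    exact hv
  set τ : ℝ := δ / ‖T (cfc f A v)‖ with hτ
  have hτ0 : 0 < τ := div_pos hδ hN
  refine ⟨-((τ : ℂ) • T (cfc f A v)), ?_, fun k q hk hq hkq => ?_⟩
  · rw [norm_neg, norm_smul, Complex.norm_real, Real.norm_eq_abs, abs_of_pos hτ0, hτ,
      div_mul_cancel₀ _ hN.ne']
  have hid : ContinuousOn (fun t : ℝ => t) (spectrum ℝ A) := continuousOn_id
  have htf : ContinuousOn (fun t => t * f t) (spectrum ℝ A) := hid.mul hfc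
  have hr : ContinuousOn (fun t => 1 - t * k t) (spectrum ℝ A) :=
    continuousOn_const.sub (hid.mul hk)
  have hB : ContinuousOn (fun t => k t * (t * f t)) (spectrum ℝ A) := hk.mul htf
  have hrec : cfc k A (adjoint T (T x + -((τ : ℂ) • T (cfc f A v)))) - x
      = -(cfc (fun t => 1 - t * k t) A x + (τ : ℂ) • cfc (fun t => k t * (t * f t)) A v) := by
    have e1 : adjoint T (T x + -((τ : ℂ) • T (cfc f A v))) = A x - (τ : ℂ) • A (cfc f A v) := by
      rw [map_add, map_neg, map_smul, ← sub_eq_add_neg]; rfl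
    have e2 : cfc (fun t => 1 - t * k t) A x = x - cfc k A (A x) := by
      rw [cfc_congr (g := fun t => 1 - k t * t) fun t _ => by simp only [mul_comm],
        cfc_sub (fun _ => (1:ℝ)) (fun t => k t * t) A continuousOn_const (hk.mul hid),
        cfc_const_one ℝ A, cfc_mul k (fun t => t) A hk hid, cfc_id' ℝ A]
      rfl
    rw [e1, mul_cfc_apply hA hfc, map_sub, map_smul, e2, cfc_mul k _ A hk htf]
    simp only [mul_apply_eq_comp]
    abel
  have hcross : 0 ≤ (inner ℂ (cfc (fun t => 1 - t * k t) A x)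
      (cfc (fun t => k t * (t * f t)) A v)).re := by
    rcases hvx with rfl | h0
    · rw [re_inner_cfc_cfc hr hB]
      have := re_inner_cfc_mono (A := A) (f := fun _ => 0)
        (k := fun t => k t * (t * f t) * (1 - t * k t)) continuousOn_const (hB.mul hr)
        (fun t _ => ?_) v
      · simpa using this
      · by_cases ht : t ∈ Icc a b
        · obtain ⟨h1, h2, -⟩ := hkq t ht
          have h3 := hf0 t
          have h4 := ha.le.trans ht.1
          positivity
        · simp [hfz t ht]
    · rw [re_inner_cfc_cfc hr hB,
        cfc_congr (g := fun t => (k t * t * (1 - t * k t)) * f t) fun t _ => by ring,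
        cfc_mul (fun t => k t * t * (1 - t * k t)) f A ((hk.mul hid).mul hr) hfc]
      change 0 ≤ (inner ℂ (cfc (fun t => k t * t * (1 - t * k t)) A (cfc f A x)) v).re
      simp [h0]
  have hamp : q * ‖T (cfc f A v)‖ ≤ ‖cfc (fun t => k t * (t * f t)) A v‖ := by
    refine le_of_sq_le_sq ?_ (norm_nonneg _)
    have e1 : ‖T (cfc f A v)‖ ^ 2 = (inner ℂ (cfc (fun t => f t * (t * f t)) A v) v).re := by
      rw [← re_inner_cfc_cfc htf hfc, ← mul_cfc_apply hA hfc, hAdef, comp_apply,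
        adjoint_inner_left, ← inner_self_eq_norm_sq (𝕜 := ℂ)]
      rfl
    have hc1 : ContinuousOn (fun t => f t * (t * f t)) (spectrum ℝ A) := hfc.mul htf
    have e2 : q ^ 2 * (inner ℂ (cfc (fun t => f t * (t * f t)) A v) v).re
        = (inner ℂ (cfc (fun t => q ^ 2 * (f t * (t * f t))) A v) v).re := by
      rw [cfc_const_mul (q ^ 2) _ A hc1, smul_apply, ← Complex.coe_smul, inner_smul_left,
        Complex.conj_ofReal, Complex.re_ofReal_mul]
    rw [mul_pow, e1, norm_sq_cfc_apply hB, e2]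
    refine re_inner_cfc_mono (continuousOn_const.mul hc1) (hB.mul hB) (fun t _ => ?_) v
    by_cases ht : t ∈ Icc a b
    · have h0 : 0 ≤ t * f t ^ 2 := mul_nonneg (ha.le.trans ht.1) (sq_nonneg _)
      have := mul_le_mul_of_nonneg_right (hkq t ht).2.2 h0
      change q ^ 2 * (f t * (t * f t)) ≤ k t * (t * f t) * (k t * (t * f t))
      linarith
    · simp [hfz t ht]
  have hsq : ‖cfc (fun t => 1 - t * k t) A x‖ ^ 2
        + (τ * ‖cfc (fun t => k t * (t * f t)) A v‖) ^ 2
      ≤ ‖cfc k A (adjoint T (T x + -((τ : ℂ) • T (cfc f A v)))) - x‖ ^ 2 := by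
    rw [hrec, norm_neg, norm_add_sq (𝕜 := ℂ), norm_smul, Complex.norm_real, Real.norm_eq_abs,
      abs_of_pos hτ0, inner_smul_right]
    have : (0:ℝ) ≤ RCLike.re ((τ : ℂ) * inner ℂ (cfc (fun t => 1 - t * k t) A x)
        (cfc (fun t => k t * (t * f t)) A v)) := by
      change 0 ≤ Complex.re _
      rw [Complex.re_ofReal_mul]
      positivity
    linarith
  refine ⟨le_of_sq_le_sq (by nlinarith [sq_nonneg (τ * ‖cfc (fun t => k t * (t * f t)) A v‖)])
    (norm_nonneg _), ?_⟩
  have h1 : q * δ ≤ τ * ‖cfc (fun t => k t * (t * f t)) A v‖ := by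
    have := mul_le_mul_of_nonneg_left hamp hτ0.le
    have e : δ = τ * ‖T (cfc f A v)‖ := by rw [hτ, div_mul_cancel₀ _ hN.ne']
    calc q * δ = τ * (q * ‖T (cfc f A v)‖) := by rw [e]; ring
      _ ≤ _ := this
  refine h1.trans (le_of_sq_le_sq ?_ (norm_nonneg _))
  linarith [sq_nonneg ‖cfc (fun t => 1 - t * k t) A x‖]

/-- converse result: under hypotheses (a), (b.i)–(b.v), (c) and an
order-source pair `(ρ,s)`, if `sup_{‖Tx-y‖≤δ} inf_{α∈(0,α₀)} ‖R_α y - x‖ = O(ρ(Θ⁻¹(δ)))`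
as `δ → 0⁺`, then `x ∈ ran(s(T*T))`. -/
theorem stmt7 (T : X →L[ℂ] Y) (hT : ¬ IsClosed (Set.range T))
    (hinj : Function.Injective T)
    (α₀ : ℝ) (hα₀ : 0 < α₀) (g : ℝ → ℝ → ℝ) (hg : IsSRM α₀ (‖T‖^2) g)
    (hgc : ∀ α ∈ Ioo (0:ℝ) α₀, ContinuousOn (g α) (Icc (0:ℝ) (‖T‖^2)))
    (ρ s : ℝ → ℝ) (hρ : MemO ρ) (hρc : ContinuousOn ρ (Ioi (0:ℝ))) (hs : MemS s)
    (γ : ℝ) (hγ : 0 < γ) (h : ℝ → ℝ) (hhpos : ∀ α ∈ Ioo (0:ℝ) α₀, 0 < h α)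
    (hh0 : Tendsto h (𝓝[>] (0:ℝ)) (𝓝 0))
    (hos : ∀ α ∈ Ioo (0:ℝ) α₀, ∀ lam ∈ Icc (h α) (‖T‖^2),
      γ * ρ α ≤ s lam * |1 - lam * g α lam|)
    (β d : ℝ) (hβ : 0 ≤ β) (hd : 0 < d)
    (htype : ∀ σ ∈ Ioc (0:ℝ) 1, ∀ t > (0:ℝ), ρ t ≤ d * σ ^ (-β) * ρ (σ * t))
    (γ₁ γ₂ lamstar c₁ : ℝ) (hγ₁ : 0 < γ₁) (hγ₂ : 0 < γ₂)
    (hlamstar : lamstar ∈ Ioc (0:ℝ) (‖T‖^2)) (hc₁ : 1 < c₁)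
    (hbi : ∀ α > (0:ℝ), ∀ lam ∈ Icc (0:ℝ) lamstar,
      0 ≤ 1 - lam * g α lam ∧ 1 - lam * g α lam ≤ 1)
    (hbii : ∀ α ∈ Ioo (0:ℝ) α₀, h α ≤ lamstar ∧
      ∀ lam : ℝ, 0 ≤ lam → lam < h α → γ₁ ≤ 1 - lam * g α lam)
    (hbiii : ∀ lam ∈ Ioc (0:ℝ) (‖T‖^2), ∀ a b : ℝ, a ∈ Ioo (0:ℝ) α₀ → b ∈ Ioo (0:ℝ) α₀ →
      a ≤ b → |1 - lam * g a lam| ≤ |1 - lam * g b lam|)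
    (hbiv : ∀ α > (0:ℝ), c₁ * α ≤ lamstar → γ₂ / α ≤ g α (c₁ * α))
    (hbv : ∀ α lam lam' : ℝ, 0 < α → α ≤ lam → lam ≤ lam' → lam' ≤ lamstar →
      g α lam' ≤ g α lam)
    (lamn : ℕ → ℝ) (c : ℝ) (hc : 1 ≤ c)
    (hspec : ∀ n, (lamn n : ℂ) ∈ spectrum ℂ (T.comp (ContinuousLinearMap.adjoint T)))
    (hanti : StrictAnti lamn) (hlpos : ∀ n, 0 < lamn n)
    (hlim : Tendsto lamn atTop (𝓝 0)) (hratio : ∀ n, lamn n ≤ c * lamn (n + 1))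
    (Θinv : ℝ → ℝ)
    (hΘinv : ∀ δ ∈ Ioo (0:ℝ) (sSup ((fun t => Real.sqrt t * ρ t) '' Ioo (0:ℝ) α₀)),
      Θinv δ ∈ Ioo (0:ℝ) α₀ ∧ Real.sqrt (Θinv δ) * ρ (Θinv δ) = δ)
    (x : X)
    (hx : (fun δ => ⨆ y : {y : Y // ‖T x - y‖ ≤ δ},
        ⨅ α : Ioo (0:ℝ) α₀, ‖Rop g T α.1 y.1 - x‖)
      =O[𝓝[>] (0:ℝ)] fun δ => ρ (Θinv δ)) :
    x ∈ Set.range (fun z => cfc s ((ContinuousLinearMap.adjoint T).comp T) z) := by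
  set A := (ContinuousLinearMap.adjoint T).comp T with hAdef
  have hpos : A.IsPositive := ContinuousLinearMap.isPositive_adjoint_comp_self T
  have hA : IsSelfAdjoint A := hpos.isSelfAdjoint
  have hT0 : 0 < ‖T‖ ^ 2 := hlamstar.1.trans_le hlamstar.2
  have hsp : ∀ t ∈ spectrum ℝ A, t ∈ Icc (0:ℝ) (‖T‖ ^ 2) := fun t ht => by
    refine ⟨spectrum_nonneg_of_nonneg
      ((ContinuousLinearMap.nonneg_iff_isPositive A).2 hpos) ht, ?_⟩
    have hX : Nontrivial X := by
      by_contra hn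
      rw [not_nontrivial_iff_subsingleton] at hn
      have : T = 0 := ContinuousLinearMap.ext fun x => by simp [Subsingleton.elim x 0]
      simp [this] at hT0
    have := spectrum.norm_le_norm_of_mem ht
    rw [hAdef, ContinuousLinearMap.norm_adjoint_comp_self, ← sq] at this
    exact (le_abs_self t).trans this
  have hAinj : Function.Injective A := by
    refine (injective_iff_map_eq_zero A).2 fun u hu => ?_
    have h1 : inner ℂ (A u) u = inner ℂ (T u) (T u) :=
      ContinuousLinearMap.adjoint_inner_left T u (T u)
    rw [hu, inner_zero_left] at h1
    exact (map_eq_zero_iff T hinj).1 (inner_self_eq_zero.1 h1.symm)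
  have hgA : ∀ α ∈ Ioo (0:ℝ) α₀, ContinuousOn (g α) (spectrum ℝ A) := fun α hα =>
    (hgc α hα).mono hsp
  have hrA : ∀ α ∈ Ioo (0:ℝ) α₀, ContinuousOn (fun t => 1 - t * g α t) (spectrum ℝ A) :=
    fun α hα => continuousOn_const.sub (continuousOn_id.mul (hgA α hα))
  obtain ⟨C, hC, hbound⟩ := hx.exists_pos
  have hbound := hbound.bound
  set κ : ℝ := C / γ₂ + 1 with hκ
  have hκ1 : 1 ≤ κ := by
    have := (div_pos hC hγ₂).le
    linarith
  set K : ℝ := κ ^ 2 with hK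
  have hK1 : 1 ≤ K := one_le_pow₀ hκ1
  have hK0 : 0 < K := zero_lt_one.trans_le hK1
  let a : ℕ → ℝ := fun n => 2 / (1 + c₁) * lamn n
  have ha0 : ∀ n, 0 < a n := fun n => mul_pos (by positivity) (hlpos n)
  have ha : Tendsto a atTop (𝓝[>] 0) := by
    refine tendsto_nhdsWithin_iff.2 ⟨?_, Eventually.of_forall ha0⟩
    simpa using hlim.const_mul (2 / (1 + c₁))
  have hKa : Tendsto (fun n => K * a n) atTop (𝓝[>] 0) := by
    refine tendsto_nhdsWithin_iff.2 ⟨?_, Eventually.of_forall fun n => mul_pos hK0 (ha0 n)⟩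
    simpa using (tendsto_nhdsWithin_iff.1 ha).1.const_mul K
  have hΘ0 : ∀ t, 0 < t → 0 < Real.sqrt t * ρ t := fun t ht =>
    mul_pos (Real.sqrt_pos.2 ht) (hρ.1 t ht)
  have hΘlim : Tendsto (fun t => Real.sqrt t * ρ t) (𝓝[>] 0) (𝓝[>] 0) := by
    refine tendsto_nhdsWithin_iff.2 ⟨?_, eventually_nhdsWithin_of_forall hΘ0⟩
    have h1 : Tendsto Real.sqrt (𝓝[>] 0) (𝓝 0) := by
      simpa using (Real.continuous_sqrt.tendsto 0).mono_left nhdsWithin_le_nhds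
    simpa using h1.mul hρ.2.2
  have hΘmono : ∀ t u, 0 < t → t < u → Real.sqrt t * ρ t < Real.sqrt u * ρ u := fun t u ht htu =>
    mul_lt_mul (Real.sqrt_lt_sqrt ht.le htu) (hρ.2.1 t u ht htu.le) (hρ.1 t ht) (Real.sqrt_nonneg _)
  have hΘeq : ∀ t ∈ Ioo (0:ℝ) α₀, Θinv (Real.sqrt t * ρ t) = t := fun t ht => by
    have hbdd : BddAbove ((fun t => Real.sqrt t * ρ t) '' Ioo (0:ℝ) α₀) := by
      refine ⟨Real.sqrt α₀ * ρ α₀, ?_⟩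
      rintro _ ⟨u, hu, rfl⟩
      exact (hΘmono u α₀ hu.1 hu.2).le
    obtain ⟨u, htu, huα⟩ := exists_between ht.2
    obtain ⟨h1, h2⟩ := hΘinv (Real.sqrt t * ρ t) ⟨hΘ0 t ht.1,
      (hΘmono t u ht.1 htu).trans_le (le_csSup hbdd ⟨u, ⟨ht.1.trans htu, huα⟩, rfl⟩)⟩
    rcases lt_trichotomy (Θinv (Real.sqrt t * ρ t)) t with h3 | h3 | h3
    · exact absurd h2 (hΘmono _ _ h1.1 h3).ne
    · exact h3
    · exact absurd h2 (hΘmono _ _ ht.1 h3).ne'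
  have key : ∀ n, a n ∈ Ioo (0:ℝ) α₀ → K * a n ∈ Ioo (0:ℝ) α₀ → c₁ * a n ≤ lamstar →
      ‖⨆ y : {y : Y // ‖T x - y‖ ≤ Real.sqrt (K * a n) * ρ (K * a n)},
        ⨅ α : Ioo (0:ℝ) α₀, ‖Rop g T α.1 y.1 - x‖‖
          ≤ C * ‖ρ (Θinv (Real.sqrt (K * a n) * ρ (K * a n)))‖ →
      ‖cfc (fun t => 1 - t * g (a n) t) A x‖ ≤ C * ρ (K * a n) := by
    intro n han hKan hcan hle
    rw [hΘeq _ hKan, Real.norm_of_nonneg (hρ.1 _ hKan.1).le] at hle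
    replace hle := (Real.le_norm_self _).trans hle
    set δ := Real.sqrt (K * a n) * ρ (K * a n) with hδ
    have hmem : lamn n ∈ spectrum ℝ A :=
      mem_spectrum_adjoint_comp_self T (hlpos n).ne' (hspec n)
    have hlo : a n < lamn n := by
      have : 2 / (1 + c₁) < 1 := (div_lt_one (by linarith)).2 (by linarith)
      exact mul_lt_of_lt_one_left (hlpos n) this
    have hhi : lamn n < c₁ * a n := by
      have : 1 < c₁ * (2 / (1 + c₁)) := by
        rw [← mul_div_assoc, one_lt_div (by linarith)]; linarith
      have := mul_lt_mul_of_pos_right this (hlpos n)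
      rw [one_mul, mul_assoc] at this
      exact this
    obtain ⟨p, hp, hk⟩ := exists_perturbation T hinj x (ha0 n) hlo hhi hmem (hΘ0 _ hKan.1)
    rw [← hδ] at hp
    set q : ℝ := γ₂ / Real.sqrt (a n) with hq
    have hsa : 0 < Real.sqrt (a n) := Real.sqrt_pos.2 (ha0 n)
    have hg01 : ∀ α > (0:ℝ), ∀ t ∈ Icc (a n) (c₁ * a n), 0 ≤ g α t ∧ 0 ≤ 1 - t * g α t := by
      intro α hα t ht
      have ht0 : 0 < t := (ha0 n).trans_le ht.1
      obtain ⟨h1, h2⟩ := hbi α hα t ⟨ht0.le, ht.2.trans hcan⟩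
      exact ⟨nonneg_of_mul_nonneg_right (by linarith : 0 ≤ t * g α t) ht0, h1⟩
    have hlow : ∀ α ∈ Ioo (0:ℝ) α₀,
        min ‖cfc (fun t => 1 - t * g (a n) t) A x‖ (q * δ) ≤ ‖Rop g T α (T x + p) - x‖ := by
      intro α hα
      rcases le_or_gt (a n) α with hle | hlt
      · refine (min_le_left _ _).trans (le_trans ?_ (hk (g α) 0 (hgA α hα) le_rfl fun t ht =>
          ⟨(hg01 α hα.1 t ht).1, (hg01 α hα.1 t ht).2, ?_⟩).1)
        · refine norm_cfc_apply_le (hrA _ han) (hrA α hα) (fun t ht => ?_) x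
          rcases (hsp t ht).1.eq_or_lt with rfl | h0
          · simp
          · exact hbiii t ⟨h0, (hsp t ht).2⟩ _ _ han hα hle
        · rw [zero_pow two_ne_zero]
          exact mul_nonneg ((ha0 n).le.trans ht.1) (sq_nonneg _)
      · refine (min_le_right _ _).trans (hk (g α) q (hgA α hα) (by positivity) fun t ht =>
          ⟨(hg01 α hα.1 t ht).1, (hg01 α hα.1 t ht).2, ?_⟩).2
        have ht0 : 0 < t := (ha0 n).trans_le ht.1
        have h1 := hbiii t ⟨ht0, ht.2.trans (hcan.trans hlamstar.2)⟩ α (a n) hα han hlt.le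
        rw [abs_of_nonneg (hg01 α hα.1 t ht).2, abs_of_nonneg (hg01 _ (ha0 n) t ht).2] at h1
        have h2 : g (a n) t ≤ g α t := le_of_mul_le_mul_left (by linarith) ht0
        have h3 : γ₂ / a n ≤ g α t :=
          ((hbiv (a n) (ha0 n) hcan).trans (hbv _ _ _ (ha0 n) ht.1 ht.2 hcan)).trans h2
        calc q ^ 2 = a n * (γ₂ / a n) ^ 2 := by
              rw [hq, div_pow, Real.sq_sqrt (ha0 n).le]
              field_simp [(ha0 n).ne']
          _ ≤ t * g α t ^ 2 := by
              have := ha0 n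
              exact mul_le_mul ht.1 (pow_le_pow_left₀ (by positivity) h3 2) (by positivity) ht0.le
    have hsup : min ‖cfc (fun t => 1 - t * g (a n) t) A x‖ (q * δ) ≤ C * ρ (K * a n) := by
      have : Nonempty (Ioo (0:ℝ) α₀) := ⟨⟨a n, han⟩⟩
      have hbb : ∀ y, BddBelow (range fun α : Ioo (0:ℝ) α₀ => ‖Rop g T α.1 y - x‖) := fun y => by
        refine ⟨0, ?_⟩
        rintro _ ⟨α, rfl⟩
        exact norm_nonneg _
      refine (le_ciInf fun α : Ioo (0:ℝ) α₀ => hlow α.1 α.2).trans (le_trans (le_ciSup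
        (f := fun y : {y : Y // ‖T x - y‖ ≤ δ} => ⨅ α : Ioo (0:ℝ) α₀, ‖Rop g T α.1 y.1 - x‖)
        ?_ ⟨T x + p, by simp [hp]⟩) hle)
      refine ⟨‖Rop g T (a n)‖ * (‖T x‖ + δ) + ‖x‖, ?_⟩
      rintro _ ⟨⟨y, hy⟩, rfl⟩
      refine (ciInf_le (hbb y) ⟨a n, han⟩).trans ((norm_sub_le _ _).trans ?_)
      have hy' : ‖y‖ ≤ ‖T x‖ + δ := by
        have := norm_sub_le (T x) (T x - y)
        rw [sub_sub_cancel] at this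
        linarith
      have := (Rop g T (a n)).le_opNorm_of_le hy'
      linarith
    have hqδ : C * ρ (K * a n) < q * δ := by
      have e : q * δ = (C + γ₂) * ρ (K * a n) := by
        rw [hq, hδ, Real.sqrt_mul hK0.le, hK, Real.sqrt_sq (zero_le_one.trans hκ1), hκ]
        field_simp
      have := mul_pos hγ₂ (hρ.1 _ hKan.1)
      rw [e]
      linarith
    exact (min_le_iff.1 hsup).resolve_right hqδ.not_ge
  refine mem_range_cfc_of_norm_cfc_le (M := C * (d * (1 / K) ^ (-β)) / γ) hA
    (fun t ht => (hsp t ht).1) hAinj hs.1 hs.2.2.2 fun ε hε => ?_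
  obtain ⟨n, h1, h2, h3, h4, h5⟩ := ((ha.eventually (Ioo_mem_nhdsGT hα₀)).and
    ((hKa.eventually (Ioo_mem_nhdsGT hα₀)).and
    ((ha.eventually (Ioo_mem_nhdsGT (div_pos hlamstar.1 (zero_lt_one.trans hc₁)))).and
    (((hΘlim.comp hKa).eventually hbound).and
    ((hh0.comp ha).eventually (gt_mem_nhds hε)))))).exists
  have hρn := hρ.1 _ h1.1
  have hcan : c₁ * a n ≤ lamstar := by
    have := ((lt_div_iff₀ (zero_lt_one.trans hc₁)).1 h3.2).le
    linarith
  have hfin := key n h1 h2 hcan h4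
  refine ⟨fun t => (γ * ρ (a n))⁻¹ * (1 - t * g (a n) t), continuousOn_const.mul (hrA _ h1),
    fun t ht hεt => ?_, ?_⟩
  · have := hos _ h1 t ⟨h5.le.trans hεt, (hsp t ht).2⟩
    rw [abs_mul, abs_of_pos (by positivity), mul_left_comm, inv_mul_eq_div,
      one_le_div (by positivity)]
    exact this
  · have hty := htype (1 / K) ⟨by positivity, (div_le_one hK0).2 hK1⟩ (K * a n) h2.1
    rw [show 1 / K * (K * a n) = a n by field_simp] at hty
    rw [cfc_const_mul _ _ A (hrA _ h1), smul_apply, norm_smul,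
      Real.norm_of_nonneg (by positivity), inv_mul_eq_div, div_le_div_iff₀ (by positivity) hγ]
    have := mul_le_mul_of_nonneg_right (hfin.trans (mul_le_mul_of_nonneg_left hty hC.le)) hγ.le
    linarith
end
end

section
/- Consider the Tikhonov–Phillips method: for α ∈ (0,α₀) and λ ∈ [0,Λ], g_α(λ) ≐ 1/(λ+α), so r_α(λ) = 1 − λg_α(λ) = α/(λ+α). Then: (i) for every λ ≥ 0, lim_{α→0⁺} ρ(α)/r_α(λ) = λ where ρ(α) ≐ α (so s_ρ(λ) = λ); (ii) λ·r_α(λ) ≤ α for all λ, α > 0 (so (s,ρ) with s(λ) = λ is a weak source-order pair); (iii) λ·r_α(λ) ≥ α/2 for all λ ≥ α (so (ρ,s) is an order-source pair with γ = 1/2 and h(α) = α). Consequently ρ(α) = α is an optimal qualification of the Tikhonov–Phillips method, with source function s_ρ(λ) = λ. -/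
open Filter Topology Set Asymptotics

noncomputable section

/-- The residual of the Tikhonov–Phillips method is `α / (lam + α)`. -/
lemma tikhonov_residual {lam α : ℝ} (h : lam + α ≠ 0) :
    1 - lam * (1 / (lam + α)) = α / (lam + α) := by
  field_simp
  ring

lemma tikhonov_mul_residual_le {lam α : ℝ} (hlam : 0 < lam) (hα : 0 < α) :
    lam * (1 - lam * (1 / (lam + α))) ≤ α := by
  rw [tikhonov_residual (by positivity), mul_div_assoc', div_le_iff₀ (by positivity)]
  nlinarith

lemma tikhonov_half_le_mul_residual {lam α : ℝ} (hα : 0 < α) (h : α ≤ lam) :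
    α / 2 ≤ lam * (1 - lam * (1 / (lam + α))) := by
  have hlam : 0 < lam := hα.trans_le h
  rw [tikhonov_residual (by positivity), mul_div_assoc', le_div_iff₀ (by positivity)]
  nlinarith

lemma tikhonov_tendsto_div_residual {lam : ℝ} (hlam : 0 ≤ lam) :
    Tendsto (fun α => α / (1 - lam * (1 / (lam + α)))) (𝓝[>] (0 : ℝ)) (𝓝 lam) := by
  have hlim : Tendsto (fun α : ℝ => lam + α) (𝓝[>] 0) (𝓝 lam) := by
    have hcont : Continuous fun α : ℝ => lam + α := by fun_prop
    simpa using (hcont.tendsto 0).mono_left nhdsWithin_le_nhds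
  refine hlim.congr' ?_
  filter_upwards [self_mem_nhdsWithin] with α hα
  have hα : 0 < α := hα
  rw [tikhonov_residual (by positivity)]
  field_simp

lemma tikhonov_limsup {lam : ℝ} (hlam : 0 < lam) :
    limsup (fun α => ((lam * |1 - lam * (1 / (lam + α))| / α : ℝ) : EReal)) (𝓝[>] (0 : ℝ)) = 1 := by
  have hlim : Tendsto (fun α : ℝ => lam / (lam + α)) (𝓝[>] 0) (𝓝 1) := by
    have hcont : ContinuousAt (fun α : ℝ => lam / (lam + α)) 0 :=
      continuousAt_const.div (by fun_prop) (by simpa using hlam.ne')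
    simpa [hlam.ne'] using hcont.tendsto.mono_left nhdsWithin_le_nhds
  have hreal : Tendsto (fun α => lam * |1 - lam * (1 / (lam + α))| / α) (𝓝[>] 0) (𝓝 1) := by
    refine hlim.congr' ?_
    filter_upwards [self_mem_nhdsWithin] with α hα
    have hα : 0 < α := hα
    rw [tikhonov_residual (by positivity), abs_of_pos (by positivity)]
    field_simp
  exact (EReal.tendsto_coe.2 hreal).limsup_eq

/-- for the Tikhonov–Phillips method `g_α(λ) = 1/(λ+α)`, with
`r_α(λ) = 1 - λ g_α(λ) = α/(λ+α)`: (i) `ρ(α)/r_α(λ) → λ` as `α → 0⁺` (so `s_ρ(λ) = λ`);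
(ii) `λ r_α(λ) ≤ α`; (iii) `λ r_α(λ) ≥ α/2` for `λ ≥ α`. Consequently `ρ(α) = α` is an
optimal qualification of the Tikhonov–Phillips method. -/
theorem stmt13 (α₀ Λ : ℝ) (hα₀ : 0 < α₀) (hΛ : 0 < Λ) :
    (∀ lam : ℝ, 0 ≤ lam →
      Tendsto (fun α => α / (1 - lam * (1 / (lam + α)))) (𝓝[>] (0:ℝ)) (𝓝 lam)) ∧
    (∀ lam > (0:ℝ), ∀ α > (0:ℝ), lam * (1 - lam * (1 / (lam + α))) ≤ α) ∧
    (∀ α > (0:ℝ), ∀ lam : ℝ, α ≤ lam → α / 2 ≤ lam * (1 - lam * (1 / (lam + α)))) ∧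
    OptimalQualification α₀ Λ (fun α lam => 1 / (lam + α)) (fun α => α) := by
  refine ⟨fun _ => tikhonov_tendsto_div_residual, fun _ hlam _ hα => tikhonov_mul_residual_le hlam hα,
    fun _ hα _ h => tikhonov_half_le_mul_residual hα h, fun lam => lam,
    ⟨continuousOn_id, rfl, fun _ => id, fun _ => id⟩,
    ⟨fun lam hlam => ?_, fun lam hlam => ?_⟩, 1 / 2, by norm_num, fun α => α, fun _ hα => hα.1,
    nhdsWithin_le_nhds, fun α hα lam hlam => ?_⟩
  · rw [tikhonov_limsup hlam.1]
    exact EReal.coe_lt_top 1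
  · rw [tikhonov_limsup hlam.1]
    exact one_pos
  · have hpos : 0 < lam := hα.1.trans_le hlam.1
    calc 1 / 2 * α = α / 2 := by ring
      _ ≤ lam * (1 - lam * (1 / (lam + α))) := tikhonov_half_le_mul_residual hα.1 hlam.1
      _ ≤ lam * |1 - lam * (1 / (lam + α))| := by gcongr; exact le_abs_self _
end
end

section
/- (Tikhonov–Phillips upper bound of convergence δ^{2/3} on ran(T*T).) Let R_α ≐ (T*T + αI)⁻¹T* for α ∈ (0,α₀) (the operator T*T + αI is boundedly invertible since T*T is positive). Then for every ζ ∈ X and x ≐ T*Tζ, and for every δ ∈ (0, α₀^{3/2}), inf_{α∈(0,α₀)} sup{‖R_α y − x‖ : y ∈ Y, ‖Tx − y‖ ≤ δ} ≤ (‖ζ‖ + 1/2)·δ^{2/3}. In particular e(x,δ) = O(δ^{2/3}) as δ → 0⁺ for every x ∈ ran(T*T). -/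
open Filter Topology Set Asymptotics

noncomputable section

variable {X Y : Type*} [NormedAddCommGroup X] [InnerProductSpace ℂ X] [CompleteSpace X]
  [NormedAddCommGroup Y] [InnerProductSpace ℂ Y] [CompleteSpace Y]

/-- The Tikhonov–Phillips regularization operators `R_α = (T*T + αI)⁻¹ T*`
(`Ring.inverse` is the genuine inverse since `T*T + αI` is boundedly invertible for
`α > 0`). -/
noncomputable def RTik (T : X →L[ℂ] Y) (α : ℝ) : Y →L[ℂ] X :=
  (Ring.inverse ((ContinuousLinearMap.adjoint T).comp T + (α : ℂ) • 1)).comp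
    (ContinuousLinearMap.adjoint T)

/-- The operator `T*T + αI` is invertible for `α > 0`. -/
theorem isUnit_adjoint_comp_self_add_smul_one (T : X →L[ℂ] Y) {α : ℝ} (hα : 0 < α) :
    IsUnit ((ContinuousLinearMap.adjoint T).comp T + (α : ℂ) • (1 : X →L[ℂ] X)) := by
  refine ContinuousLinearMap.isUnit_of_forall_le_norm_inner_map _ (c := .mk α hα.le) hα fun u => ?_
  refine le_trans ?_ (RCLike.abs_re_le_norm _)
  refine le_trans ?_ (le_abs_self _)
  have h : RCLike.re (inner ℂ (((ContinuousLinearMap.adjoint T).comp T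
      + (α : ℂ) • (1 : X →L[ℂ] X)) u) u) = ‖T u‖ ^ 2 + α * ‖u‖ ^ 2 := by
    simp [ContinuousLinearMap.adjoint_inner_left,
      inner_self_eq_norm_sq_to_K, ← Complex.ofReal_pow]
  rw [h, NNReal.coe_mk]
  nlinarith [sq_nonneg ‖T u‖]

/-- `R_α w` solves the regularized normal equation. -/
theorem adjoint_apply_RTik_add (T : X →L[ℂ] Y) {α : ℝ} (hα : 0 < α) (w : Y) :
    ContinuousLinearMap.adjoint T (T (RTik T α w)) + (α : ℂ) • RTik T α w
      = ContinuousLinearMap.adjoint T w := by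
  have h := Ring.mul_inverse_cancel _ (isUnit_adjoint_comp_self_add_smul_one T hα)
  simpa [RTik] using DFunLike.congr_fun h (ContinuousLinearMap.adjoint T w)

theorem two_mul_sqrt_mul_norm_RTik_le (T : X →L[ℂ] Y) {α : ℝ} (hα : 0 < α) (w : Y) :
    2 * √α * ‖RTik T α w‖ ≤ ‖w‖ := by
  set u := RTik T α w with hu
  have h := congrArg (fun z => RCLike.re (inner ℂ z u)) (adjoint_apply_RTik_add T hα w)
  simp only [← hu] at h
  have h' : ‖T u‖ ^ 2 + α * ‖u‖ ^ 2 = RCLike.re (inner ℂ w (T u)) := by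
    rw [← ContinuousLinearMap.adjoint_inner_left, ← h]
    simp [ContinuousLinearMap.adjoint_inner_left,
      inner_self_eq_norm_sq_to_K, ← Complex.ofReal_pow]
  have hle : RCLike.re (inner ℂ w (T u)) ≤ ‖w‖ * ‖T u‖ := re_inner_le_norm w (T u)
  refine (pow_le_pow_iff_left₀ (by positivity) (norm_nonneg _) two_ne_zero).1 ?_
  rw [mul_pow, mul_pow, Real.sq_sqrt hα.le]
  nlinarith [sq_nonneg (2 * ‖T u‖ - ‖w‖)]

/-- The filtered source element `(T*T + αI)⁻¹T*Tζ` is no larger than `ζ`. -/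
theorem norm_RTik_apply_le (T : X →L[ℂ] Y) {α : ℝ} (hα : 0 < α) (ζ : X) :
    ‖RTik T α (T ζ)‖ ≤ ‖ζ‖ := by
  set v := RTik T α (T ζ) with hv
  have h : (α : ℂ) • v = ContinuousLinearMap.adjoint T (T (ζ - v)) := by
    rw [map_sub, map_sub, ← adjoint_apply_RTik_add T hα (T ζ), ← hv]
    abel
  have h' : α * RCLike.re (inner ℂ v (ζ - v)) = ‖T (ζ - v)‖ ^ 2 := by
    have := congrArg (fun z => RCLike.re (inner ℂ z (ζ - v))) h
    rw [ContinuousLinearMap.adjoint_inner_left, inner_self_eq_norm_sq, inner_smul_left] at this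
    rwa [Complex.conj_ofReal, RCLike.re_eq_complex_re, Complex.re_ofReal_mul] at this
  have hnn : 0 ≤ RCLike.re (inner ℂ v (ζ - v)) :=
    nonneg_of_mul_nonneg_right (h' ▸ sq_nonneg _) hα
  have hsq := norm_add_sq (𝕜 := ℂ) v (ζ - v)
  rw [add_sub_cancel] at hsq
  refine (pow_le_pow_iff_left₀ (by positivity) (norm_nonneg _) two_ne_zero).1 ?_
  nlinarith [sq_nonneg ‖ζ - v‖]

/-- The approximation error of Tikhonov–Phillips regularization on `ran(T*T)`. -/
theorem norm_RTik_apply_sub_le (T : X →L[ℂ] Y) {α : ℝ} (hα : 0 < α) (ζ : X) :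
    ‖RTik T α (T (ContinuousLinearMap.adjoint T (T ζ))) - ContinuousLinearMap.adjoint T (T ζ)‖
      ≤ α * ‖ζ‖ := by
  have h : RTik T α (T (ContinuousLinearMap.adjoint T (T ζ)))
      - ContinuousLinearMap.adjoint T (T ζ) = -((α : ℂ) • RTik T α (T ζ)) := by
    have hc := Ring.inverse_mul_cancel _ (isUnit_adjoint_comp_self_add_smul_one T hα)
    have h := DFunLike.congr_fun hc (ContinuousLinearMap.adjoint T (T ζ))
    simp only [mul_apply_eq_comp, add_apply, smul_apply, one_apply_eq_self, map_add, map_smul,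
      ContinuousLinearMap.comp_apply] at h
    simp only [RTik, ContinuousLinearMap.comp_apply]
    rw [sub_eq_iff_eq_add, neg_add_eq_sub, eq_sub_iff_add_eq]
    exact h
  rw [h, norm_neg, norm_smul, Complex.norm_real, Real.norm_of_nonneg hα.le]
  exact mul_le_mul_of_nonneg_left (norm_RTik_apply_le T hα ζ) hα.le

theorem totErr_nonneg (α₀ : ℝ) (T : X →L[ℂ] Y) (R : ℝ → Y →L[ℂ] X) (x : X) (δ : ℝ) :
    0 ≤ totErr α₀ T R x δ :=
  Real.iInf_nonneg fun _ => Real.iSup_nonneg fun _ => norm_nonneg _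

theorem totErr_le_of_forall {α₀ α : ℝ} (hα : α ∈ Ioo 0 α₀) (T : X →L[ℂ] Y)
    (R : ℝ → Y →L[ℂ] X) (x : X) {δ c : ℝ} (hc : 0 ≤ c)
    (h : ∀ y, ‖T x - y‖ ≤ δ → ‖R α y - x‖ ≤ c) : totErr α₀ T R x δ ≤ c :=
  (ciInf_le ⟨0, by rintro _ ⟨a, rfl⟩; exact Real.iSup_nonneg fun _ => norm_nonneg _⟩
    (⟨α, hα⟩ : Ioo 0 α₀)).trans (Real.iSup_le (fun y => h y.1 y.2) hc)

theorem totErr_RTik_le (T : X →L[ℂ] Y) {α₀ : ℝ} (hα₀ : 0 < α₀) (ζ : X) {δ : ℝ}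
    (hδ : δ ∈ Ioo (0:ℝ) (α₀ ^ ((3:ℝ)/2))) :
    totErr α₀ T (RTik T) (((ContinuousLinearMap.adjoint T).comp T) ζ) δ
      ≤ (‖ζ‖ + 1/2) * δ ^ ((2:ℝ)/3) := by
  obtain ⟨hδ0, hδ1⟩ := hδ
  have hα : 0 < δ ^ ((2:ℝ)/3) := Real.rpow_pos_of_pos hδ0 _
  have hlt : δ ^ ((2:ℝ)/3) < α₀ := by
    have := Real.rpow_lt_rpow hδ0.le hδ1 (by norm_num : (0:ℝ) < 2/3)
    rwa [← Real.rpow_mul hα₀.le, show (3:ℝ)/2 * (2/3) = 1 by norm_num, Real.rpow_one] at this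
  have hδeq : √(δ ^ ((2:ℝ)/3)) * δ ^ ((2:ℝ)/3) = δ := by
    rw [Real.sqrt_eq_rpow, ← Real.rpow_mul hδ0.le, ← Real.rpow_add hδ0]
    norm_num
  refine totErr_le_of_forall ⟨hα, hlt⟩ T _ _ (by positivity) fun y hy => ?_
  set α := δ ^ ((2:ℝ)/3)
  set x := ((ContinuousLinearMap.adjoint T).comp T) ζ with hx
  have hbias : ‖RTik T α (T x) - x‖ ≤ α * ‖ζ‖ := norm_RTik_apply_sub_le T hα ζ
  have hnoise : ‖RTik T α (T x - y)‖ ≤ α / 2 := by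
    have h := (two_mul_sqrt_mul_norm_RTik_le T hα (T x - y)).trans hy
    have hs : 0 < √α := Real.sqrt_pos.2 hα
    refine le_of_mul_le_mul_left ?_ hs
    linarith
  have hsplit : RTik T α y - x = (RTik T α (T x) - x) - RTik T α (T x - y) := by
    rw [map_sub]; abel
  rw [hsplit]
  linarith [norm_sub_le (RTik T α (T x) - x) (RTik T α (T x - y))]

/-- Tikhonov–Phillips upper bound `δ^{2/3}` on `ran(T*T)`: for every
`ζ ∈ X`, `x = T*Tζ` and `δ ∈ (0,α₀^{3/2})`, `e(x,δ) ≤ (‖ζ‖ + 1/2)·δ^{2/3}`; in particular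
`e(x,δ) = O(δ^{2/3})` as `δ → 0⁺` for every `x ∈ ran(T*T)`. -/
theorem stmt14 (T : X →L[ℂ] Y) (hT : ¬ IsClosed (Set.range T)) (α₀ : ℝ) (hα₀ : 0 < α₀) :
    (∀ ζ : X, ∀ δ ∈ Ioo (0:ℝ) (α₀ ^ ((3:ℝ)/2)),
      totErr α₀ T (RTik T) (((ContinuousLinearMap.adjoint T).comp T) ζ) δ
        ≤ (‖ζ‖ + 1/2) * δ ^ ((2:ℝ)/3)) ∧
    (∀ x ∈ Set.range (fun z => ((ContinuousLinearMap.adjoint T).comp T) z),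
      (fun δ => totErr α₀ T (RTik T) x δ) =O[𝓝[>] (0:ℝ)] fun δ => δ ^ ((2:ℝ)/3)) := by
  refine ⟨fun ζ δ hδ => totErr_RTik_le T hα₀ ζ hδ, ?_⟩
  rintro _ ⟨ζ, rfl⟩
  refine IsBigO.of_bound (‖ζ‖ + 1/2) ?_
  filter_upwards [Ioo_mem_nhdsGT (Real.rpow_pos_of_pos hα₀ ((3:ℝ)/2))] with δ hδ
  rw [Real.norm_of_nonneg (totErr_nonneg _ _ _ _ _),
    Real.norm_of_nonneg (Real.rpow_nonneg hδ.1.le _)]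
  exact totErr_RTik_le T hα₀ ζ hδ
end
end

section
/- (Saturation lower bound for Tikhonov–Phillips.) Let T be injective and suppose there exist a sequence {λ_n} in the spectrum of TT* and a constant c ≥ 1 such that λ_n decreases strictly to 0 and λ_n/λ_{n+1} ≤ c for every n. Let R_α ≐ (T*T + αI)⁻¹T* for α ∈ (0,α₀). Then for every x* ∈ X with x* ≠ 0, limsup_{δ→0⁺} e(x*,δ)/δ^{2/3} > 0. -/
open Filter Topology Set Asymptotics

noncomputable section

variable {X Y : Type*} [NormedAddCommGroup X] [InnerProductSpace ℂ X] [CompleteSpace X]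
  [NormedAddCommGroup Y] [InnerProductSpace ℂ Y] [CompleteSpace Y]

theorem adjoint_comp_self_add_smul_one_isUnit (T : X →L[ℂ] Y) {α : ℝ} (hα : 0 < α) :
    IsUnit ((ContinuousLinearMap.adjoint T).comp T + (α : ℂ) • 1) := by
  have hpos : (0 : X →L[ℂ] X) ≤ (ContinuousLinearMap.adjoint T).comp T :=
    (ContinuousLinearMap.nonneg_iff_isPositive _).2 (ContinuousLinearMap.isPositive_adjoint_comp_self T)
  by_contra h
  have hmem : (-α : ℝ) ∈ spectrum ℝ ((ContinuousLinearMap.adjoint T).comp T) := by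
    rw [spectrum.mem_iff]
    intro h'
    apply h
    have := h'.neg
    convert this using 1
    ext x
    simp [Algebra.algebraMap_eq_smul_one, add_comm]
  have := spectrum_nonneg_of_nonneg hpos hmem
  linarith

theorem self_comp_adjoint_add_smul_one_isUnit (T : X →L[ℂ] Y) {α : ℝ} (hα : 0 < α) :
    IsUnit (T.comp (ContinuousLinearMap.adjoint T) + (α : ℂ) • 1) := by
  simpa using adjoint_comp_self_add_smul_one_isUnit (ContinuousLinearMap.adjoint T) hα

theorem RTik_eq_adjoint_comp_inverse (T : X →L[ℂ] Y) {α : ℝ} (hα : 0 < α) :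
    RTik T α = (ContinuousLinearMap.adjoint T).comp
      (Ring.inverse (T.comp (ContinuousLinearMap.adjoint T) + (α : ℂ) • 1)) := by
  have hX := adjoint_comp_self_add_smul_one_isUnit T hα
  have hY := self_comp_adjoint_add_smul_one_isUnit T hα
  ext y
  obtain ⟨w, rfl⟩ : ∃ w, (T.comp (ContinuousLinearMap.adjoint T) + (α : ℂ) • 1) w = y :=
    ⟨Ring.inverse (T.comp (ContinuousLinearMap.adjoint T) + (α : ℂ) • 1) y, by
      rw [← mul_apply_eq_comp, Ring.mul_inverse_cancel _ hY]; rfl⟩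
  have h1 : (ContinuousLinearMap.adjoint T)
      ((T.comp (ContinuousLinearMap.adjoint T) + (α : ℂ) • 1) w) =
      ((ContinuousLinearMap.adjoint T).comp T + (α : ℂ) • 1) (ContinuousLinearMap.adjoint T w) := by
    simp
  calc RTik T α ((T.comp (ContinuousLinearMap.adjoint T) + (α : ℂ) • 1) w)
      = ContinuousLinearMap.adjoint T w := by
        rw [RTik, ContinuousLinearMap.comp_apply, h1, ← mul_apply_eq_comp,
          Ring.inverse_mul_cancel _ hX, one_apply_eq_self]
    _ = _ := by
        rw [ContinuousLinearMap.comp_apply, ← mul_apply_eq_comp, Ring.inverse_mul_cancel _ hY,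
          one_apply_eq_self]

/-- The bias of Tikhonov–Phillips regularization is at least of order `α`. -/
theorem le_norm_RTik_apply_sub (T : X →L[ℂ] Y) {α : ℝ} (hα : 0 < α) (x : X) :
    α * ‖x‖ ≤ (‖T‖ ^ 2 + α) * ‖RTik T α (T x) - x‖ := by
  have hX := adjoint_comp_self_add_smul_one_isUnit T hα
  set B := (ContinuousLinearMap.adjoint T).comp T + (α : ℂ) • 1 with hB
  have hres : B (RTik T α (T x) - x) = -((α : ℂ) • x) := by
    have h1 : B (RTik T α (T x)) = ContinuousLinearMap.adjoint T (T x) := by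
      simp only [RTik, ContinuousLinearMap.comp_apply]
      rw [← hB, ← mul_apply_eq_comp, Ring.mul_inverse_cancel _ hX]
      rfl
    rw [map_sub, h1]
    simp [hB]
  have hBn : ‖B‖ ≤ ‖T‖ ^ 2 + α := by
    refine (norm_add_le _ _).trans (add_le_add ?_ ?_)
    · rw [ContinuousLinearMap.norm_adjoint_comp_self, sq]
    · rw [norm_smul, Complex.norm_real, Real.norm_of_nonneg hα.le]
      exact mul_le_of_le_one_right hα.le ContinuousLinearMap.norm_id_le
  calc α * ‖x‖ = ‖B (RTik T α (T x) - x)‖ := by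
        rw [hres, norm_neg, norm_smul, Complex.norm_real, Real.norm_of_nonneg hα.le]
    _ ≤ ‖B‖ * ‖RTik T α (T x) - x‖ := B.le_opNorm _
    _ ≤ _ := by gcongr

/-- If `l` is in the spectrum of `A`, then `l / (l + α)²` is in the spectrum of
`(A + α)⁻¹ A (A + α)⁻¹`. -/
theorem div_sq_mem_spectrum {R : Type*} [Ring R] [Algebra ℂ R] {A : R} {l α : ℂ}
    (hlα : l + α ≠ 0) (hu : IsUnit (A + α • 1)) (hl : l ∈ spectrum ℂ A) :
    l / (l + α) ^ 2 ∈
      spectrum ℂ (Ring.inverse (A + α • 1) * A * Ring.inverse (A + α • 1)) := by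
  rw [spectrum.mem_iff] at hl ⊢
  intro h
  apply hl
  set B := A + α • (1 : R) with hB
  set m := l / (l + α) ^ 2
  have hml : m * (l + α) ^ 2 = l := div_mul_cancel₀ _ (pow_ne_zero 2 hlα)
  clear_value m
  have hkey : B * (algebraMap ℂ R m - Ring.inverse B * A * Ring.inverse B) * B =
      (algebraMap ℂ R l - A) * ((1 - 2 * α * m - l * m) • 1 - m • A) := by
    calc B * (algebraMap ℂ R m - Ring.inverse B * A * Ring.inverse B) * B
        = m • (B * B) - (B * Ring.inverse B) * A * (Ring.inverse B * B) := by
          rw [Algebra.algebraMap_eq_smul_one]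
          simp only [mul_sub, sub_mul, mul_smul_comm, smul_mul_assoc, mul_one, mul_assoc]
      _ = m • (B * B) - A := by
          rw [Ring.mul_inverse_cancel _ hu, Ring.inverse_mul_cancel _ hu, one_mul, mul_one]
      _ = _ := by
          rw [Algebra.algebraMap_eq_smul_one]
          simp only [hB, mul_sub, sub_mul, mul_add, add_mul, mul_smul_comm, smul_mul_assoc,
            mul_one, one_mul]
          match_scalars <;> first | ring1 | linear_combination hml
  have hunit := (hu.mul h).mul hu
  rw [hkey] at hunit
  refine ((Commute.isUnit_mul_iff ?_).1 hunit).1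
  rw [Algebra.algebraMap_eq_smul_one]
  simp only [Commute, SemiconjBy, mul_sub, sub_mul, mul_smul_comm, smul_mul_assoc, mul_one, one_mul]
  module

/-- Noise amplification of Tikhonov–Phillips regularization. -/
theorem div_sq_le_norm_RTik_sq (T : X →L[ℂ] Y) {α l : ℝ} (hα : 0 < α) (hl : 0 < l)
    (hmem : (l : ℂ) ∈ spectrum ℂ (T.comp (ContinuousLinearMap.adjoint T))) :
    l / (l + α) ^ 2 ≤ ‖RTik T α‖ ^ 2 := by
  have hY := self_comp_adjoint_add_smul_one_isUnit T hα
  set A := T.comp (ContinuousLinearMap.adjoint T) with hA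
  have hne : (l : ℂ) + α ≠ 0 := by exact_mod_cast (add_pos hl hα).ne'
  have hs := div_sq_mem_spectrum hne hY hmem
  have hsa : IsSelfAdjoint (A + (α : ℂ) • 1) := by
    refine IsSelfAdjoint.add ?_ ?_
    · simp [hA, ContinuousLinearMap.isSelfAdjoint_iff', ContinuousLinearMap.adjoint_comp]
    · exact IsSelfAdjoint.smul (by simp [isSelfAdjoint_iff]) (IsSelfAdjoint.one _)
  have hUsa : ContinuousLinearMap.adjoint (Ring.inverse (A + (α : ℂ) • 1)) =
      Ring.inverse (A + (α : ℂ) • 1) := by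
    rw [← ContinuousLinearMap.star_eq_adjoint, ← Ring.inverse_star, hsa.star_eq]
  have hRR : (ContinuousLinearMap.adjoint (RTik T α)).comp (RTik T α) =
      Ring.inverse (A + (α : ℂ) • 1) * A * Ring.inverse (A + (α : ℂ) • 1) := by
    rw [RTik_eq_adjoint_comp_inverse T hα, ContinuousLinearMap.adjoint_comp, hUsa,
      ContinuousLinearMap.adjoint_adjoint]
    rfl
  have : Nontrivial (Y →L[ℂ] Y) := by
    by_contra hn
    rw [not_nontrivial_iff_subsingleton] at hn
    simp [spectrum.of_subsingleton] at hmem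
  have hn := spectrum.norm_le_norm_of_mem hs
  rw [← hRR, ContinuousLinearMap.norm_adjoint_comp_self, ← sq] at hn
  convert hn using 1
  rw [← Complex.ofReal_add, ← Complex.ofReal_pow, ← Complex.ofReal_div, Complex.norm_real,
    Real.norm_of_nonneg (by positivity)]

section WorstCase

variable {E F : Type*} [NormedAddCommGroup E] [InnerProductSpace ℂ E]
  [NormedAddCommGroup F] [InnerProductSpace ℂ F]
  (T : E →L[ℂ] F) (R : F →L[ℂ] E) (x : E) {δ : ℝ}

theorem bddAbove_range_norm_apply_sub :
    BddAbove (range fun y : {y : F // ‖T x - y‖ ≤ δ} => ‖R y.1 - x‖) := by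
  refine ⟨‖R‖ * (‖T x‖ + δ) + ‖x‖, ?_⟩
  rintro _ ⟨⟨y, hy⟩, rfl⟩
  have hy' : ‖y‖ ≤ ‖T x‖ + δ := by
    have := norm_sub_norm_le y (T x)
    rw [norm_sub_rev] at this
    linarith
  calc ‖R y - x‖ ≤ ‖R y‖ + ‖x‖ := norm_sub_le _ _
    _ ≤ ‖R‖ * ‖y‖ + ‖x‖ := by gcongr; exact R.le_opNorm y
    _ ≤ _ := by gcongr

theorem norm_apply_sub_le_iSup (hδ : 0 ≤ δ) :
    ‖R (T x) - x‖ ≤ ⨆ y : {y : F // ‖T x - y‖ ≤ δ}, ‖R y.1 - x‖ :=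
  le_ciSup (bddAbove_range_norm_apply_sub T R x) ⟨T x, by simpa using hδ⟩

theorem mul_norm_le_iSup (hδ : 0 < δ) :
    δ * ‖R‖ ≤ ⨆ y : {y : F // ‖T x - y‖ ≤ δ}, ‖R y.1 - x‖ := by
  set S := ⨆ y : {y : F // ‖T x - y‖ ≤ δ}, ‖R y.1 - x‖
  have hS0 : 0 ≤ S := Real.iSup_nonneg fun _ => norm_nonneg _
  have hz : ∀ z : F, ‖z‖ ≤ δ → ‖R z‖ ≤ S := by
    intro z hz
    have h1 : ‖R (T x + z) - x‖ ≤ S :=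
      le_ciSup (bddAbove_range_norm_apply_sub T R x) ⟨T x + z, by simpa using hz⟩
    have h2 : ‖R (T x - z) - x‖ ≤ S :=
      le_ciSup (bddAbove_range_norm_apply_sub T R x) ⟨T x - z, by simpa using hz⟩
    have h3 : (2 : ℝ) * ‖R z‖ ≤ S + S := by
      calc (2 : ℝ) * ‖R z‖ = ‖(2 : ℂ) • R z‖ := by simp [norm_smul]
        _ = ‖(R (T x + z) - x) - (R (T x - z) - x)‖ := by
          rw [map_add, map_sub, two_smul]; congr 1; abel
        _ ≤ S + S := (norm_sub_le _ _).trans (add_le_add h1 h2)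
    linarith
  rw [← le_div_iff₀' hδ]
  refine R.opNorm_le_bound (by positivity) fun z => ?_
  rcases eq_or_ne z 0 with rfl | hz0
  · simp
  have hzpos : 0 < ‖z‖ := norm_pos_iff.2 hz0
  have := hz (((δ / ‖z‖ : ℝ) : ℂ) • z) (by
    rw [norm_smul, Complex.norm_real, Real.norm_of_nonneg (by positivity)]
    exact (div_mul_cancel₀ _ hzpos.ne').le)
  rw [map_smul, norm_smul, Complex.norm_real, Real.norm_of_nonneg (by positivity)] at this
  rw [div_mul_eq_mul_div, div_le_iff₀ hzpos] at this
  rw [div_mul_eq_mul_div, le_div_iff₀ hδ]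
  linarith

end WorstCase

/-- At the noise level `l ^ (3/2)`, with `l` in the spectrum of `TT*`, the total error is at least
of order `l`. -/
theorem mul_le_totErr (T : X →L[ℂ] Y) {α₀ : ℝ} (hα₀ : 0 < α₀) (x : X) {l : ℝ} (hl : 0 < l)
    (hmem : (l : ℂ) ∈ spectrum ℂ (T.comp (ContinuousLinearMap.adjoint T))) :
    min (‖x‖ / (‖T‖ ^ 2 + α₀)) (1 / 2) * l ≤ totErr α₀ T (RTik T) x (l * √l) := by
  have : Nonempty (Ioo (0 : ℝ) α₀) := ⟨⟨α₀ / 2, by constructor <;> linarith⟩⟩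
  have hsq : 0 < √l := Real.sqrt_pos.2 hl
  have hδ : 0 < l * √l := by positivity
  refine le_ciInf ?_
  rintro ⟨α, hα, hαα₀⟩
  rcases le_total l α with h | h
  · refine le_trans ?_ (norm_apply_sub_le_iSup T (RTik T α) x hδ.le)
    have hb := le_norm_RTik_apply_sub T hα x
    calc min (‖x‖ / (‖T‖ ^ 2 + α₀)) (1 / 2) * l ≤ ‖x‖ / (‖T‖ ^ 2 + α₀) * α := by
          gcongr; exact min_le_left _ _
      _ = α * ‖x‖ / (‖T‖ ^ 2 + α₀) := by ring
      _ ≤ ‖RTik T α (T x) - x‖ := by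
          rw [div_le_iff₀ (by positivity), mul_comm ‖_ - _‖]
          refine hb.trans ?_
          gcongr
  · refine le_trans ?_ (mul_norm_le_iSup T (RTik T α) x hδ)
    have hnoise := div_sq_le_norm_RTik_sq T hα hl hmem
    have h1 : 1 / 2 ≤ √l * ‖RTik T α‖ := by
      refine le_of_sq_le_sq ?_ (by positivity)
      rw [mul_pow, Real.sq_sqrt hl.le]
      calc (1 / 2 : ℝ) ^ 2 = l * (l / (l + l) ^ 2) := by field_simp; norm_num
        _ ≤ l * (l / (l + α) ^ 2) := by gcongr
        _ ≤ _ := by gcongr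
    calc min (‖x‖ / (‖T‖ ^ 2 + α₀)) (1 / 2) * l ≤ 1 / 2 * l := by
          gcongr; exact min_le_right _ _
      _ ≤ (√l * ‖RTik T α‖) * l := by gcongr
      _ = _ := by ring

/-- saturation lower bound for Tikhonov–Phillips: if `T` is injective and
the spectrum of `TT*` contains a sequence `λ_n ↓ 0` with `λ_n/λ_{n+1} ≤ c`, then for every
`x* ≠ 0`, `limsup_{δ→0⁺} e(x*,δ)/δ^{2/3} > 0`. -/
theorem stmt15 (T : X →L[ℂ] Y) (hT : ¬ IsClosed (Set.range T))
    (hinj : Function.Injective T) (α₀ : ℝ) (hα₀ : 0 < α₀)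
    (lamn : ℕ → ℝ) (c : ℝ) (hc : 1 ≤ c)
    (hspec : ∀ n, (lamn n : ℂ) ∈ spectrum ℂ (T.comp (ContinuousLinearMap.adjoint T)))
    (hanti : StrictAnti lamn) (hlpos : ∀ n, 0 < lamn n)
    (hlim : Tendsto lamn atTop (𝓝 0)) (hratio : ∀ n, lamn n ≤ c * lamn (n + 1)) :
    ∀ xs : X, xs ≠ 0 →
      0 < Filter.limsup
        (fun δ => ((totErr α₀ T (RTik T) xs δ / δ ^ ((2:ℝ)/3) : ℝ) : EReal))
        (𝓝[>] (0:ℝ)) := by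
  intro xs hxs
  set k := min (‖xs‖ / (‖T‖ ^ 2 + α₀)) (1 / 2) with hk
  have hkpos : 0 < k := lt_min (div_pos (norm_pos_iff.2 hxs) (by positivity)) (by norm_num)
  refine lt_of_lt_of_le (b := ((k : ℝ) : EReal)) (by exact_mod_cast hkpos) ?_
  refine le_limsup_of_frequently_le ?_
  have htend : Tendsto (fun n => lamn n * √(lamn n)) atTop (𝓝[>] (0 : ℝ)) := by
    refine tendsto_nhdsWithin_iff.2 ⟨?_, Eventually.of_forall fun n => ?_⟩
    · simpa using hlim.mul ((Real.continuous_sqrt.tendsto 0).comp hlim)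
    · exact mul_pos (hlpos n) (Real.sqrt_pos.2 (hlpos n))
  refine htend.frequently (Frequently.of_forall fun n => ?_)
  have hl := hlpos n
  have hpow : (lamn n * √(lamn n)) ^ ((2 : ℝ) / 3) = lamn n := by
    rw [Real.sqrt_eq_rpow, ← Real.rpow_one_add' hl.le (by norm_num), ← Real.rpow_mul hl.le]
    norm_num
  rw [EReal.coe_le_coe_iff, hpow, le_div_iff₀ hl]
  exact mul_le_totErr T hα₀ xs hl (hspec n)
end
end

section
/- (Converse result for Tikhonov–Phillips.) Let T be injective and suppose there exist a sequence {λ_n} in the spectrum of TT* and a constant c ≥ 1 such that λ_n decreases strictly to 0 and λ_n/λ_{n+1} ≤ c for every n. Let R_α ≐ (T*T + αI)⁻¹T* for α ∈ (0,α₀). If x ∈ X satisfies e(x,δ) = O(δ^{2/3}) as δ → 0⁺, then x ∈ ran(T*T). -/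
open Filter Topology Set Asymptotics

noncomputable section

variable {X Y : Type*} [NormedAddCommGroup X] [InnerProductSpace ℂ X] [CompleteSpace X]
  [NormedAddCommGroup Y] [InnerProductSpace ℂ Y] [CompleteSpace Y]

section Resolvent

variable {H : Type*} [NormedAddCommGroup H] [InnerProductSpace ℂ H]

lemma complex_re_inner_self (w : H) : (inner ℂ w w).re = ‖w‖ ^ 2 :=
  inner_self_eq_norm_sq (𝕜 := ℂ) w

/-- The squared norm of the resolvent `(A + βI)⁻¹ x` grows as `β` decreases, by at least the
squared distance between the two resolvents. -/
lemma norm_sub_sq_le_of_isPositive {A : H →L[ℂ] H} (hA : A.IsPositive) {α β : ℝ}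
    (hβ : 0 < β) (hβα : β ≤ α) {u v : H}
    (huv : A u + (β : ℂ) • u = A v + (α : ℂ) • v) :
    ‖u - v‖ ^ 2 ≤ ‖u‖ ^ 2 - ‖v‖ ^ 2 := by
  rcases hβα.eq_or_lt with rfl | hlt
  · have h0 : A (u - v) + (β : ℂ) • (u - v) = 0 := by
      rw [map_sub, smul_sub, sub_add_sub_comm, huv, sub_self]
    have h1 := congrArg (fun w => (inner ℂ w (u - v)).re) h0
    have h2 : 0 ≤ (inner ℂ (A (u - v)) (u - v)).re := hA.re_inner_nonneg_left (u - v)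
    simp only [inner_add_left, inner_smul_left, inner_zero_left,
      Complex.add_re, Complex.conj_ofReal, Complex.re_ofReal_mul, Complex.zero_re,
      complex_re_inner_self] at h1
    have h3 : ‖u - v‖ ^ 2 = 0 := by
      have := sq_nonneg ‖u - v‖
      nlinarith
    have h4 : u = v := by simpa [sub_eq_zero] using h3
    simp [h4]
  · have h0 : A (u - v) + (β : ℂ) • (u - v) = ((α - β : ℝ) : ℂ) • v := by
      rw [map_sub, smul_sub, sub_add_sub_comm, huv]
      push_cast
      module
    have h1 := congrArg (fun w => (inner ℂ w (u - v)).re) h0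
    have h2 : 0 ≤ (inner ℂ (A (u - v)) (u - v)).re := hA.re_inner_nonneg_left (u - v)
    simp only [inner_add_left, inner_smul_left,
      Complex.add_re, Complex.conj_ofReal, Complex.re_ofReal_mul,
      complex_re_inner_self] at h1
    have h3 : 0 ≤ (inner ℂ v (u - v)).re := by
      have := sq_nonneg ‖u - v‖
      refine nonneg_of_mul_nonneg_right ?_ (sub_pos.2 hlt)
      rw [← h1]
      positivity
    have h4 := norm_add_sq (𝕜 := ℂ) v (u - v)
    rw [add_sub_cancel] at h4
    change _ = _ + 2 * (inner ℂ v (u - v)).re + _ at h4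
    linarith

/-- The residual norm `β ‖(A + βI)⁻¹ x‖` is non-decreasing in `β`. -/
lemma mul_norm_le_mul_norm_of_isPositive {A : H →L[ℂ] H} (hA : A.IsPositive) {α β : ℝ}
    (hβ : 0 < β) (hβα : β ≤ α) {u v : H}
    (huv : A u + (β : ℂ) • u = A v + (α : ℂ) • v) :
    β * ‖u‖ ≤ α * ‖v‖ := by
  have hα : 0 < α := hβ.trans_le hβα
  have hw : (α : ℂ) • v = (β : ℂ) • u + A (u - v) := by
    rw [map_sub, add_comm, sub_add_eq_add_sub, huv, add_sub_cancel_left]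
  have h0 : A (u - v) + (α : ℂ) • (u - v) = ((α - β : ℝ) : ℂ) • u := by
    rw [smul_sub, hw]
    push_cast
    module
  have h3 : 0 ≤ (inner ℂ ((β : ℂ) • u) (A (u - v))).re := by
    rcases hβα.eq_or_lt with rfl | hlt
    · have := norm_sub_sq_le_of_isPositive hA hβ le_rfl huv
      have h5 := norm_sub_sq_le_of_isPositive hA hβ le_rfl huv.symm
      have h4 : u - v = 0 := by
        rw [← norm_eq_zero, ← sq_eq_zero_iff]
        rw [norm_sub_rev] at h5
        have := sq_nonneg ‖u - v‖
        linarith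
      simp [h4]
    · have h1 := congrArg (fun w => (inner ℂ w (A (u - v))).re) h0
      have h2 : 0 ≤ (inner ℂ (u - v) (A (u - v))).re := hA.re_inner_nonneg_right (u - v)
      simp only [inner_add_left, inner_smul_left,
        Complex.add_re, Complex.conj_ofReal, Complex.re_ofReal_mul,
      complex_re_inner_self] at h1
      rw [inner_smul_left, Complex.conj_ofReal, Complex.re_ofReal_mul]
      refine mul_nonneg hβ.le (nonneg_of_mul_nonneg_right ?_ (sub_pos.2 hlt))
      rw [← h1]
      positivity
  have h4 := norm_add_sq (𝕜 := ℂ) ((β : ℂ) • u) (A (u - v))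
  change _ = _ + 2 * (inner ℂ ((β : ℂ) • u) (A (u - v))).re + _ at h4
  rw [← hw, norm_smul, norm_smul, Complex.norm_of_nonneg hα.le, Complex.norm_of_nonneg hβ.le] at h4
  refine le_of_sq_le_sq ?_ (by positivity)
  have := sq_nonneg ‖A (u - v)‖
  linarith

variable [CompleteSpace H]

/-- If the resolvents `(A + βI)⁻¹ x` stay bounded as `β → 0⁺`, then `x ∈ ran A`. -/
lemma mem_range_of_resolvent_bounded {A : H →L[ℂ] H} (hA : A.IsPositive) {x : H} {z : ℝ → H}
    (hz : ∀ β > 0, A (z β) + (β : ℂ) • z β = x) {C : ℝ}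
    (hC : ∀ᶠ β in 𝓝[>] (0 : ℝ), ‖z β‖ ≤ C) : x ∈ Set.range A := by
  have hle : ∀ α β : ℝ, 0 < β → β ≤ α → ‖z β - z α‖ ^ 2 ≤ ‖z β‖ ^ 2 - ‖z α‖ ^ 2 :=
    fun α β hβ hβα => norm_sub_sq_le_of_isPositive hA hβ hβα
      ((hz β hβ).trans (hz α (hβ.trans_le hβα)).symm)
  let b : ℕ → ℝ := fun n => 1 / ((n : ℝ) + 1)
  have hb : ∀ n, 0 < b n := fun n => Nat.one_div_pos_of_nat
  have hb0 : Tendsto b atTop (𝓝 0) := tendsto_one_div_add_atTop_nhds_zero_nat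
  have hb0' : Tendsto b atTop (𝓝[>] 0) :=
    tendsto_nhdsWithin_iff.2 ⟨hb0, .of_forall hb⟩
  have hbanti : ∀ m n, m ≤ n → b n ≤ b m := fun m n h => Nat.one_div_le_one_div h
  have hmono : Monotone fun n => ‖z (b n)‖ ^ 2 := fun m n h => by
    have := hle _ _ (hb n) (hbanti m n h)
    have := sq_nonneg ‖z (b n) - z (b m)‖
    dsimp only
    linarith
  obtain ⟨N, hN⟩ := eventually_atTop.1 (hb0'.eventually hC)
  have hbdd : BddAbove (Set.range fun n => ‖z (b n)‖ ^ 2) := by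
    refine ⟨C ^ 2, ?_⟩
    rintro _ ⟨n, rfl⟩
    refine (hmono (le_max_left n N)).trans ?_
    exact pow_le_pow_left₀ (norm_nonneg _) (hN _ (le_max_right n N)) 2
  have hcau := (tendsto_atTop_ciSup hmono hbdd).cauchySeq
  have hzc : CauchySeq fun n => z (b n) := by
    rw [Metric.cauchySeq_iff'] at hcau ⊢
    intro ε hε
    obtain ⟨M, hM⟩ := hcau (ε ^ 2) (by positivity)
    refine ⟨M, fun n hn => ?_⟩
    have h1 := hM n hn
    rw [Real.dist_eq] at h1
    rw [dist_eq_norm]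
    refine lt_of_pow_lt_pow_left₀ 2 hε.le ?_
    exact (hle _ _ (hb n) (hbanti M n hn)).trans_lt ((le_abs_self _).trans_lt h1)
  obtain ⟨w, hw⟩ := cauchySeq_tendsto_of_complete hzc
  refine ⟨w, ?_⟩
  have h1 : Tendsto (fun n => A (z (b n)) + (b n : ℂ) • z (b n)) atTop
      (𝓝 (A w + ((0 : ℝ) : ℂ) • w)) :=
    ((A.continuous.tendsto w).comp hw).add
      (((Complex.continuous_ofReal.tendsto 0).comp hb0).smul hw)
  have h2 : Tendsto (fun n => A (z (b n)) + (b n : ℂ) • z (b n)) atTop (𝓝 x) := by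
    simp only [hz _ (hb _)]
    exact tendsto_const_nhds
  simpa using tendsto_nhds_unique h1 h2

lemma isUnit_add_smul_one_of_isPositive {A : H →L[ℂ] H} (hA : A.IsPositive) {α : ℝ}
    (hα : 0 < α) : IsUnit (A + (α : ℂ) • (1 : H →L[ℂ] H)) := by
  have h0 : (0 : H →L[ℂ] H) ≤ A := (ContinuousLinearMap.nonneg_iff_isPositive A).2 hA
  have h1 : -α ∉ spectrum ℝ A := fun h => by
    have := spectrum_nonneg_of_nonneg h0 h
    linarith
  rw [spectrum.notMem_iff] at h1
  convert h1.neg using 1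
  rw [Algebra.algebraMap_eq_smul_one, neg_smul, neg_sub, sub_neg_eq_add, Complex.coe_smul]

end Resolvent

/-- A bound `ρ` on the norm of `T* (TT* + αI)⁻¹` controls `√λ / (λ + α)` on the spectrum. -/
lemma le_sq_mul_of_mem_spectrum {T : X →L[ℂ] Y} {α ρ lam : ℝ}
    (hlam : (lam : ℂ) ∈ spectrum ℂ (T.comp (ContinuousLinearMap.adjoint T)))
    (h : ∀ u : Y, ‖ContinuousLinearMap.adjoint T u‖ ≤
      ρ * ‖T (ContinuousLinearMap.adjoint T u) + (α : ℂ) • u‖) :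
    lam ≤ ρ ^ 2 * (lam + α) ^ 2 := by
  set B : Y →L[ℂ] Y := T.comp (ContinuousLinearMap.adjoint T) with hB
  have hBpos : B.IsPositive := ContinuousLinearMap.isPositive_self_comp_adjoint T
  have hBs : IsSelfAdjoint B := hBpos.isSelfAdjoint
  have hlamR : lam ∈ spectrum ℝ B := by
    rw [← spectrum.algebraMap_mem_iff ℂ]
    exact hlam
  let p : Polynomial ℝ := Polynomial.C (ρ ^ 2) * (Polynomial.X + Polynomial.C α) ^ 2 - Polynomial.X
  have hmem : p.eval lam ∈ spectrum ℝ (Polynomial.aeval B p) :=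
    spectrum.subset_polynomial_aeval B p ⟨lam, hlamR, rfl⟩
  have hp : Polynomial.aeval B p = (ρ ^ 2) • (B + α • (1 : Y →L[ℂ] Y)) ^ 2 - B := by
    simp [p, Algebra.algebraMap_eq_smul_one, smul_pow]
  have hS : IsSelfAdjoint (B + α • (1 : Y →L[ℂ] Y)) :=
    hBs.add ((IsSelfAdjoint.all α).smul (.one _))
  have hnonneg : 0 ≤ Polynomial.aeval B p := by
    rw [hp, ContinuousLinearMap.nonneg_iff_isPositive, ContinuousLinearMap.isPositive_def']
    refine ⟨((IsSelfAdjoint.all _).smul (hS.pow 2)).sub hBs, fun u => ?_⟩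
    rw [ContinuousLinearMap.reApplyInnerSelf_apply]
    have h1 : inner ℂ (((B + α • (1 : Y →L[ℂ] Y)) ^ 2) u) u =
        ((‖B u + (α : ℂ) • u‖ ^ 2 : ℝ) : ℂ) := by
      rw [pow_two, mul_apply_eq_comp, ← ContinuousLinearMap.adjoint_inner_right,
        ← ContinuousLinearMap.star_eq_adjoint, hS.star_eq, inner_self_eq_norm_sq_to_K]
      simp
    have h2 : inner ℂ (B u) u = ((‖ContinuousLinearMap.adjoint T u‖ ^ 2 : ℝ) : ℂ) := by
      rw [hB, ContinuousLinearMap.comp_apply, ← ContinuousLinearMap.adjoint_inner_right,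
        inner_self_eq_norm_sq_to_K]
      simp
    have h3 := pow_le_pow_left₀ (norm_nonneg _) (h u) 2
    rw [mul_pow] at h3
    rw [_root_.sub_apply, _root_.smul_apply, inner_sub_left,
      ← Complex.coe_smul, inner_smul_left, h1, h2]
    simp only [Complex.conj_ofReal, ← Complex.ofReal_mul, ← Complex.ofReal_sub]
    rw [RCLike.re_eq_complex_re, Complex.ofReal_re]
    exact sub_nonneg.2 h3
  have := spectrum_nonneg_of_nonneg hnonneg hmem
  simp only [p, Polynomial.eval_sub, Polynomial.eval_mul, Polynomial.eval_C, Polynomial.eval_pow,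
    Polynomial.eval_add, Polynomial.eval_X] at this
  linarith

/-- A sequence decreasing to `0` at most geometrically meets `[α, c α]` for every small `α`. -/
lemma exists_mem_Icc_of_le_mul_succ {l : ℕ → ℝ} {c α : ℝ} (hc : 0 ≤ c) (hα : 0 < α)
    (hlim : Tendsto l atTop (𝓝 0)) (hratio : ∀ n, l n ≤ c * l (n + 1)) (h0 : α ≤ l 0) :
    ∃ n, l n ∈ Icc α (c * α) := by
  classical
  have hex : ∃ m, l m < α := (hlim.eventually (gt_mem_nhds hα)).exists
  obtain ⟨n, hn⟩ : ∃ n, Nat.find hex = n + 1 :=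
    Nat.exists_eq_succ_of_ne_zero fun h => (Nat.find_spec hex).not_ge (h ▸ h0)
  refine ⟨n, not_lt.1 (Nat.find_min hex (by omega)), (hratio n).trans ?_⟩
  exact mul_le_mul_of_nonneg_left (hn ▸ (Nat.find_spec hex).le) hc

/-- The two components of the worst-case error of a linear reconstruction: the approximation
error and the propagated noise. -/
lemma norm_le_of_iSup_lt {E F : Type*} [NormedAddCommGroup E] [NormedSpace ℂ E]
    [NormedAddCommGroup F] [NormedSpace ℂ F] (T : E →L[ℂ] F) (R : F →L[ℂ] E) (x : E)
    {δ N : ℝ} (hδ : 0 ≤ δ)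
    (h : (⨆ y : {y : F // ‖T x - y‖ ≤ δ}, ‖R y.1 - x‖) < N) :
    ‖R (T x) - x‖ ≤ N ∧ ∀ v : F, ‖v‖ ≤ δ → ‖R v‖ ≤ N := by
  have hbdd : BddAbove (Set.range fun y : {y : F // ‖T x - y‖ ≤ δ} => ‖R y.1 - x‖) := by
    refine ⟨‖R‖ * δ + ‖R (T x) - x‖, ?_⟩
    rintro _ ⟨⟨y, hy⟩, rfl⟩
    have h1 : R y - x = -R (T x - y) + (R (T x) - x) := by
      rw [map_sub]
      abel
    dsimp only
    rw [h1]
    refine (norm_add_le _ _).trans ?_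
    rw [norm_neg]
    gcongr
    exact R.le_opNorm_of_le hy
  have hle : ∀ y : F, ‖T x - y‖ ≤ δ → ‖R y - x‖ ≤ N := fun y hy =>
    (le_ciSup hbdd ⟨y, hy⟩).trans h.le
  refine ⟨hle _ (by simpa using hδ), fun v hv => ?_⟩
  have h1 := hle (T x + v) (by simpa using hv)
  have h2 := hle (T x - v) (by simpa using hv)
  have h3 : (2 : ℝ) * ‖R v‖ ≤ N + N := by
    have : (2 : ℂ) • R v = (R (T x + v) - x) - (R (T x - v) - x) := by
      rw [map_add, map_sub, two_smul]
      abel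
    calc (2 : ℝ) * ‖R v‖ = ‖(2 : ℂ) • R v‖ := by simp [norm_smul]
      _ ≤ _ := by
        rw [this]
        exact (norm_sub_le _ _).trans (add_le_add h1 h2)
  linarith

/-- converse result for Tikhonov–Phillips: if `T` is injective, the spectrum
of `TT*` contains a sequence `λ_n ↓ 0` with `λ_n/λ_{n+1} ≤ c`, and `e(x,δ) = O(δ^{2/3})` as
`δ → 0⁺`, then `x ∈ ran(T*T)`. -/
theorem stmt16 (T : X →L[ℂ] Y) (hT : ¬ IsClosed (Set.range T))
    (hinj : Function.Injective T) (α₀ : ℝ) (hα₀ : 0 < α₀)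
    (lamn : ℕ → ℝ) (c : ℝ) (hc : 1 ≤ c)
    (hspec : ∀ n, (lamn n : ℂ) ∈ spectrum ℂ (T.comp (ContinuousLinearMap.adjoint T)))
    (hanti : StrictAnti lamn) (hlpos : ∀ n, 0 < lamn n)
    (hlim : Tendsto lamn atTop (𝓝 0)) (hratio : ∀ n, lamn n ≤ c * lamn (n + 1))
    (x : X)
    (hx : (fun δ => totErr α₀ T (RTik T) x δ) =O[𝓝[>] (0:ℝ)] fun δ => δ ^ ((2:ℝ)/3)) :
    x ∈ Set.range (fun z => ((ContinuousLinearMap.adjoint T).comp T) z) := by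
  set A : X →L[ℂ] X := (ContinuousLinearMap.adjoint T).comp T with hA
  have hApos : A.IsPositive := ContinuousLinearMap.isPositive_adjoint_comp_self T
  have hleft : ∀ α : ℝ, 0 < α → ∀ w,
      Ring.inverse (A + (α : ℂ) • (1 : X →L[ℂ] X)) (A w + (α : ℂ) • w) = w := fun α hα w =>
    DFunLike.congr_fun
      (Ring.inverse_mul_cancel _ (isUnit_add_smul_one_of_isPositive hApos hα)) w
  have hright : ∀ β > (0 : ℝ), A (Ring.inverse (A + (β : ℂ) • (1 : X →L[ℂ] X)) x) +
      (β : ℂ) • Ring.inverse (A + (β : ℂ) • (1 : X →L[ℂ] X)) x = x := fun β hβ =>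
    DFunLike.congr_fun
      (Ring.mul_inverse_cancel _ (isUnit_add_smul_one_of_isPositive hApos hβ)) x
  obtain ⟨K, hK, hbound⟩ := hx.exists_pos
  have hbound := hbound.bound
  let L : ℝ := (2 * K) ^ 2 * (c + 1) ^ 2
  have hL : 0 < L := by positivity
  have htend : Tendsto (fun β : ℝ => (L * β) ^ ((3 : ℝ) / 2)) (𝓝[>] 0) (𝓝[>] 0) := by
    refine tendsto_nhdsWithin_iff.2 ⟨?_, ?_⟩
    · have : ContinuousAt (fun β : ℝ => (L * β) ^ ((3 : ℝ) / 2)) 0 :=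
        (continuous_const.mul continuous_id).continuousAt.rpow_const (.inr (by norm_num))
      have h := this.tendsto.mono_left (nhdsWithin_le_nhds (s := Ioi 0))
      simpa [Real.zero_rpow (by norm_num : (3 : ℝ) / 2 ≠ 0)] using h
    · filter_upwards [self_mem_nhdsWithin] with β hβ
      exact Real.rpow_pos_of_pos (mul_pos hL hβ) _
  refine mem_range_of_resolvent_bounded hApos hright (C := 2 * K * L) ?_
  filter_upwards [htend.eventually hbound, self_mem_nhdsWithin,
    nhdsWithin_le_nhds (gt_mem_nhds (hlpos 0))] with β hβ1 hβ0 hβl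
  rw [mem_Ioi] at hβ0
  have ht : 0 < L * β := mul_pos hL hβ0
  set δ : ℝ := (L * β) ^ ((3 : ℝ) / 2) with hδ
  have hδ0 : 0 < δ := Real.rpow_pos_of_pos ht _
  have hδ23 : δ ^ ((2 : ℝ) / 3) = L * β := by
    rw [hδ, ← Real.rpow_mul ht.le]
    norm_num
  have hδ2 : δ ^ 2 = (L * β) ^ 3 := by
    rw [hδ, ← Real.rpow_natCast, ← Real.rpow_mul ht.le, ← Real.rpow_natCast]
    norm_num
  have hlt : totErr α₀ T (RTik T) x δ < 2 * K * (L * β) := by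
    rw [hδ23, Real.norm_of_nonneg ht.le] at hβ1
    have := (le_abs_self _).trans hβ1
    have := mul_pos hK ht
    linarith
  have : Nonempty (Ioo (0 : ℝ) α₀) := ⟨⟨α₀ / 2, by constructor <;> linarith⟩⟩
  obtain ⟨⟨α, hα0, _⟩, hαlt⟩ := exists_lt_of_ciInf_lt hlt
  obtain ⟨happ, hnoise⟩ := norm_le_of_iSup_lt T _ x hδ0.le hαlt
  have hβα : β ≤ α := by
    by_contra! hαβ
    obtain ⟨n, hn1, hn2⟩ := exists_mem_Icc_of_le_mul_succ (zero_le_one.trans hc) hα0 hlim hratio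
      (hαβ.trans hβl).le
    have hR : ∀ v : Y, ‖RTik T α v‖ ≤ 2 * K * (L * β) / δ * ‖v‖ := fun v => by
      rcases eq_or_ne v 0 with rfl | hv
      · simp
      have hv0 : 0 < ‖v‖ := norm_pos_iff.2 hv
      have h1 : ‖((δ / ‖v‖ : ℝ) : ℂ)‖ = δ / ‖v‖ := Complex.norm_of_nonneg (by positivity)
      have h2 := hnoise (((δ / ‖v‖ : ℝ) : ℂ) • v)
        (by rw [norm_smul, h1, div_mul_cancel₀ _ hv0.ne'])
      rw [map_smul, norm_smul, h1, div_mul_eq_mul_div, div_le_iff₀ hv0] at h2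
      rw [div_mul_eq_mul_div, le_div_iff₀' hδ0]
      exact h2
    have hspec' := le_sq_mul_of_mem_spectrum (hspec n) (α := α) (ρ := 2 * K * (L * β) / δ)
      fun u => by
        refine le_trans (le_of_eq ?_) (hR _)
        have h1 := hleft α hα0 (ContinuousLinearMap.adjoint T u)
        rw [RTik, ContinuousLinearMap.comp_apply, map_add, map_smul]
        exact congrArg norm h1.symm
    rw [div_pow, hδ2] at hspec'
    have h1 : (2 * K * (L * β)) ^ 2 / (L * β) ^ 3 = (2 * K) ^ 2 / (L * β) := by
      field_simp
    rw [h1] at hspec'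
    have h2 : (lamn n + α) ^ 2 ≤ ((c + 1) * α) ^ 2 :=
      pow_le_pow_left₀ (add_nonneg (hlpos n).le hα0.le) (by linarith) 2
    have h3 : α ≤ (2 * K) ^ 2 / (L * β) * ((c + 1) * α) ^ 2 :=
      hn1.trans (hspec'.trans (by gcongr))
    have h4 : (2 * K) ^ 2 / (L * β) * ((c + 1) * α) ^ 2 = α * (α / β) := by
      simp only [L]
      field_simp
    rw [h4] at h3
    have h5 : α / β < 1 := (div_lt_one hβ0).2 hαβ
    nlinarith
  set zα := Ring.inverse (A + (α : ℂ) • (1 : X →L[ℂ] X)) x with hzα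
  have happ' : α * ‖zα‖ ≤ 2 * K * (L * β) := by
    have h1 : RTik T α (T x) - x = -((α : ℂ) • zα) := by
      have := hleft α hα0 x
      rw [map_add, map_smul, ← hzα] at this
      rw [sub_eq_iff_eq_add, neg_add_eq_sub, eq_sub_iff_add_eq]
      exact this
    rwa [h1, norm_neg, norm_smul, Complex.norm_of_nonneg hα0.le] at happ
  have hmono := mul_norm_le_mul_norm_of_isPositive hApos hβ0 hβα
    ((hright β hβ0).trans (hright α hα0).symm)
  refine le_of_mul_le_mul_left ?_ hβ0
  linarith [hmono.trans happ']
end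
end

section
/- Fix k > 0, Λ > 0 and α₀ ∈ (0, Λ/3]. For the family {g_α^k}_{α∈(0,α₀)} defined in the context: (i) r_α^k(λ) ≐ 1 − λ·g_α^k(λ) = α^k·λ^{3/2} + v_α^k(λ) for all λ > 0 and α ∈ (0,α₀); (ii) with s(λ) ≐ λ^k and ρ(α) ≐ α^k, one has s(λ)·r_α^k(λ) ≥ ρ(α) for all α ∈ (0,α₀) and λ ∈ [3α, Λ], so (ρ,s) is an order-source pair with γ = 1 and h(α) = 3α; (iii) for every λ ∈ (0,Λ], 0 < limsup_{α→0⁺} s(λ)·r_α^k(λ)/ρ(α) < ∞, so (s,ρ) is a strong source-order pair. Consequently ρ(α) = α^k is an optimal qualification of {g_α^k}. -/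
open Filter Topology Set Asymptotics

noncomputable section

/-- The auxiliary function `u_α^k` of the example. -/
noncomputable def uak (k α lam : ℝ) : ℝ :=
  if lam < α then Real.exp (-(lam / Real.sqrt α)) / lam
  else if lam < 3 * α then Real.exp (-Real.sqrt (lam / α)) / lam
  else Real.exp (-Real.sqrt (lam / α)) / lam + α ^ k / lam ^ (k + 1)

/-- The spectral regularization method `g_α^k` of the example
(`g_α^k(0) = 1/√α`, the limit of `g_α^k(λ)` as `λ → 0⁺`). -/
noncomputable def gak (k α lam : ℝ) : ℝ :=
  if lam ≤ 0 then 1 / Real.sqrt α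
  else 1 / lam - α ^ k * Real.sqrt lam - uak k α lam

/-- The auxiliary function `v_α^k` of the example. -/
noncomputable def vak (k α lam : ℝ) : ℝ :=
  if lam < α then Real.exp (-(lam / Real.sqrt α))
  else if lam < 3 * α then Real.exp (-Real.sqrt (lam / α))
  else Real.exp (-Real.sqrt (lam / α)) + (α / lam) ^ k

theorem mul_uak {k α lam : ℝ} (hα : 0 < α) (hlam : 0 < lam) :
    lam * uak k α lam = vak k α lam := by
  unfold uak vak
  split_ifs
  · field_simp
  · field_simp
  · rw [Real.rpow_add_one hlam.ne', Real.div_rpow hα.le hlam.le]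
    have : lam ^ k ≠ 0 := (Real.rpow_pos_of_pos hlam k).ne'
    field_simp

theorem residual_gak {k α lam : ℝ} (hα : 0 < α) (hlam : 0 < lam) :
    1 - lam * gak k α lam = α ^ k * lam ^ ((3:ℝ)/2) + vak k α lam := by
  have h32 : lam ^ ((3:ℝ)/2) = lam * √lam := by
    rw [show (3:ℝ)/2 = 1 + 1/2 by norm_num, Real.rpow_add hlam, Real.rpow_one,
      ← Real.sqrt_eq_rpow]
  rw [gak, if_neg hlam.not_ge, h32, ← mul_uak hα hlam]
  field_simp
  ring

/-- On `λ ≥ 3α`, the weighted residual `λ^k r_α^k(λ) / α^k`, written in terms of `√(λ/α)`. -/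
theorem rpow_mul_residual_gak_div {k α lam : ℝ} (hα : 0 < α) (h : 3 * α ≤ lam) :
    lam ^ k * (1 - lam * gak k α lam) / α ^ k =
      lam ^ (k + 3/2) + √(lam / α) ^ (2 * k) * Real.exp (-√(lam / α)) + 1 := by
  have hlam : 0 < lam := by linarith
  have hαk : α ^ k ≠ 0 := (Real.rpow_pos_of_pos hα k).ne'
  have hlamk : lam ^ k ≠ 0 := (Real.rpow_pos_of_pos hlam k).ne'
  have hsqrt : √(lam / α) ^ (2 * k) = lam ^ k / α ^ k := by
    rw [Real.rpow_mul (Real.sqrt_nonneg _), Real.rpow_two, Real.sq_sqrt (by positivity),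
      Real.div_rpow hlam.le hα.le]
  rw [residual_gak hα hlam, vak, if_neg (by linarith), if_neg (by linarith), hsqrt,
    Real.rpow_add hlam, Real.div_rpow hα.le hlam.le]
  field_simp
  ring

theorem rpow_le_rpow_mul_residual_gak {k α lam : ℝ} (hα : 0 < α) (h : 3 * α ≤ lam) :
    α ^ k ≤ lam ^ k * (1 - lam * gak k α lam) := by
  have hlam : 0 < lam := by linarith
  rw [← one_le_div (Real.rpow_pos_of_pos hα k), rpow_mul_residual_gak_div hα h]
  have : 0 ≤ lam ^ (k + 3/2) + √(lam / α) ^ (2 * k) * Real.exp (-√(lam / α)) := by positivity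
  linarith

theorem residual_gak_nonneg {k α lam : ℝ} (hα : 0 < α) (hlam : 0 < lam) :
    0 ≤ 1 - lam * gak k α lam := by
  have : 0 ≤ vak k α lam := by
    unfold vak
    split_ifs <;> positivity
  rw [residual_gak hα hlam]
  positivity

theorem tendsto_rpow_mul_abs_residual_gak_div (k : ℝ) {lam : ℝ} (hlam : 0 < lam) :
    Tendsto (fun α => lam ^ k * |1 - lam * gak k α lam| / α ^ k) (𝓝[>] 0)
      (𝓝 (lam ^ (k + 3/2) + 1)) := by
  have hsqrt : Tendsto (fun α : ℝ => √(lam / α)) (𝓝[>] 0) atTop :=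
    Real.tendsto_sqrt_atTop.comp (tendsto_inv_nhdsGT_zero.const_mul_atTop hlam)
  have hexp : Tendsto (fun α : ℝ => √(lam / α) ^ (2 * k) * Real.exp (-√(lam / α)))
      (𝓝[>] 0) (𝓝 0) := by
    simpa [Function.comp_def] using
      (tendsto_rpow_mul_exp_neg_mul_atTop_nhds_zero (2 * k) 1 one_pos).comp hsqrt
  have hlim := (hexp.const_add (lam ^ (k + 3/2))).add_const 1
  rw [add_zero] at hlim
  refine hlim.congr' ?_
  filter_upwards [Ioo_mem_nhdsGT (show (0:ℝ) < lam / 3 by positivity)] with α hα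
  rw [abs_of_nonneg (residual_gak_nonneg hα.1 hlam),
    rpow_mul_residual_gak_div hα.1 (by linarith [hα.2])]

theorem limsup_rpow_mul_abs_residual_gak_div (k : ℝ) {lam : ℝ} (hlam : 0 < lam) :
    limsup (fun α => ((lam ^ k * |1 - lam * gak k α lam| / α ^ k : ℝ) : EReal)) (𝓝[>] 0) =
      ((lam ^ (k + 3/2) + 1 : ℝ) : EReal) :=
  ((continuous_coe_real_ereal.tendsto _).comp
    (tendsto_rpow_mul_abs_residual_gak_div k hlam)).limsup_eq

theorem strongSourceOrderPair_gak (k Λ : ℝ) :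
    StrongSourceOrderPair Λ (gak k) (fun lam => lam ^ k) (fun α => α ^ k) := by
  refine ⟨fun lam hlam => ?_, fun lam hlam => ?_⟩
  · rw [limsup_rpow_mul_abs_residual_gak_div k hlam.1]
    exact EReal.coe_lt_top _
  · rw [limsup_rpow_mul_abs_residual_gak_div k hlam.1]
    have := Real.rpow_pos_of_pos hlam.1 (k + 3/2)
    exact EReal.coe_pos.2 (by linarith)

theorem orderSourcePair_gak (k Λ α₀ : ℝ) :
    OrderSourcePair α₀ Λ (gak k) (fun α => α ^ k) (fun lam => lam ^ k) := by
  refine ⟨1, one_pos, fun α => 3 * α, fun α hα => mul_pos three_pos hα.1, ?_, ?_⟩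
  · exact ((continuous_const_mul (3:ℝ)).tendsto' 0 0 (mul_zero 3)).mono_left nhdsWithin_le_nhds
  · intro α hα lam hlam
    have h : 3 * α ≤ lam := hlam.1
    have hpos : 0 < lam := by linarith [hα.1]
    rw [one_mul, abs_of_nonneg (residual_gak_nonneg hα.1 hpos)]
    exact rpow_le_rpow_mul_residual_gak hα.1 h

theorem memS_rpow {k : ℝ} (hk : 0 < k) : MemS (fun lam => lam ^ k) :=
  ⟨(Real.continuous_rpow_const hk.le).continuousOn, Real.zero_rpow hk.ne',
    fun _ ht => Real.rpow_nonneg ht k, fun _ ht => Real.rpow_pos_of_pos ht k⟩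

/-- for `0 < α₀ ≤ Λ/3`: (i) `r_α^k(λ) = α^k λ^{3/2} + v_α^k(λ)` for `λ > 0`;
(ii) with `s(λ) = λ^k`, `ρ(α) = α^k`, `s(λ) r_α^k(λ) ≥ ρ(α)` for `λ ∈ [3α,Λ]`, so `(ρ,s)` is
an order-source pair (with `γ = 1`, `h(α) = 3α`); (iii) `(s,ρ)` is a strong source-order
pair. Consequently `ρ(α) = α^k` is an optimal qualification of `{g_α^k}`. -/
theorem stmt17 (k : ℝ) (hk : 0 < k) (Λ α₀ : ℝ) (hΛ : 0 < Λ) (hα₀ : 0 < α₀)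
    (hα₀Λ : α₀ ≤ Λ / 3) :
    (∀ α ∈ Ioo (0:ℝ) α₀, ∀ lam > (0:ℝ),
      1 - lam * gak k α lam = α ^ k * lam ^ ((3:ℝ)/2) + vak k α lam) ∧
    (∀ α ∈ Ioo (0:ℝ) α₀, ∀ lam : ℝ, 3 * α ≤ lam → lam ≤ Λ →
      α ^ k ≤ lam ^ k * (1 - lam * gak k α lam)) ∧
    OrderSourcePair α₀ Λ (gak k) (fun α => α ^ k) (fun lam => lam ^ k) ∧
    StrongSourceOrderPair Λ (gak k) (fun lam => lam ^ k) (fun α => α ^ k) ∧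
    OptimalQualification α₀ Λ (gak k) (fun α => α ^ k) := by
  exact ⟨fun α hα lam hlam => residual_gak hα.1 hlam,
    fun α hα lam h _ => rpow_le_rpow_mul_residual_gak hα.1 h,
    orderSourcePair_gak k Λ α₀, strongSourceOrderPair_gak k Λ,
    _, memS_rpow hk, strongSourceOrderPair_gak k Λ, orderSourcePair_gak k Λ α₀⟩
end
end
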